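/- arXiv:2306.04115 — 9 statements merged into one kernel-verified Lean document; each statement's English description precedes it below -/
import Mathlib

section
/- Let k, s, l be positive integers and let B_1,…,B_l be subsets of ℕ each of size at most k. Set T = B_1 ∪ … ∪ B_l and suppose |T| ≥ s·k. Let ℱ = { B_{i_1} ∪ … ∪ B_{i_r} : 1 ≤ r ≤ l, 1 ≤ i_1,…,i_r ≤ l } be the family of all unions of nonempty subfamilies. Then |ℱ| ≥ 2^s − 1. -/
theorem stmt2 (k s l : ℕ) (hk : 0 < k) (hs : 0 < s) (hl : 0 < l)
    (B : Fin l → Finset ℕ) (hB : ∀ i, (B i).card ≤ k)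
    (hT : s * k ≤ (Finset.univ.sup B).card) :
    2 ^ s - 1 ≤
      ((((Finset.univ : Finset (Fin l)).powerset.filter Finset.Nonempty).image
        fun I => I.sup B).card) := by
  obtain ⟨J, hJ, hmin⟩ := Finset.exists_min_image
    ((Finset.univ : Finset (Finset (Fin l))).filter fun J => J.sup B = Finset.univ.sup B)
    Finset.card ⟨Finset.univ, by simp⟩
  have hJ' : J.sup B = Finset.univ.sup B := (Finset.mem_filter.mp hJ).2
  have hcard : s ≤ J.card := by
    have h1 : (J.sup B).card ≤ J.card * k := by
      rw [Finset.sup_eq_biUnion]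
      exact Finset.card_biUnion_le_card_mul _ _ _ fun i _ => hB i
    rw [hJ'] at h1
    exact Nat.le_of_mul_le_mul_right (hT.trans h1) hk
  have key : ∀ I₁ I₂ : Finset (Fin l), I₁ ⊆ J → I₂ ⊆ J → I₁.sup B = I₂.sup B → I₁ ⊆ I₂ := by
    intro I₁ I₂ h₁ h₂ he j hj
    by_contra hn
    have hjJ := h₁ hj
    have hsub : I₂ ⊆ J.erase j := fun x hx =>
      Finset.mem_erase.mpr ⟨fun h => hn (h ▸ hx), h₂ hx⟩
    have hb : B j ≤ (J.erase j).sup B :=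
      (Finset.le_sup hj).trans (he.le.trans (Finset.sup_mono hsub))
    have hE : (J.erase j).sup B = Finset.univ.sup B := by
      rw [← hJ']
      conv_rhs => rw [← Finset.insert_erase hjJ, Finset.sup_insert]
      exact (sup_eq_right.mpr hb).symm
    have := hmin (J.erase j) (by simp [hE])
    have := Finset.card_erase_lt_of_mem hjJ
    omega
  calc 2 ^ s - 1 ≤ 2 ^ J.card - 1 :=
        Nat.sub_le_sub_right (Nat.pow_le_pow_right (by norm_num) hcard) 1
    _ = (J.powerset.erase ∅).card := by
        rw [Finset.card_erase_of_mem (Finset.empty_mem_powerset J), Finset.card_powerset]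
    _ = ((J.powerset.erase ∅).image fun I => I.sup B).card := by
        refine (Finset.card_image_of_injOn ?_).symm
        intro I₁ h₁ I₂ h₂ he
        have h₁' := Finset.mem_powerset.mp (Finset.mem_of_mem_erase (Finset.mem_coe.mp h₁))
        have h₂' := Finset.mem_powerset.mp (Finset.mem_of_mem_erase (Finset.mem_coe.mp h₂))
        exact (key _ _ h₁' h₂' he).antisymm (key _ _ h₂' h₁' he.symm)
    _ ≤ _ := by
        refine Finset.card_le_card (Finset.image_subset_image ?_)
        intro I hI
        simp only [Finset.mem_filter, Finset.mem_powerset]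
        exact ⟨Finset.subset_univ _, Finset.nonempty_iff_ne_empty.mpr (Finset.ne_of_mem_erase hI)⟩
end

section
/- Let k, s, l be positive integers and let B_1,…,B_l be subsets of ℕ each of size at most k. Set T = B_1 ∪ … ∪ B_l and suppose |T| ≥ s·k. Let ℱ be the family of all unions of nonempty subfamilies of {B_1,…,B_l}. Then there exists a set S ⊆ T with |S| = s such that for every nonempty X ⊆ S there is some B ∈ ℱ with B ∩ S = X. -/
theorem stmt3 (k s l : ℕ) (hk : 0 < k) (hs : 0 < s) (hl : 0 < l)
    (B : Fin l → Finset ℕ) (hB : ∀ i, (B i).card ≤ k)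
    (hT : s * k ≤ (Finset.univ.sup B).card) :
    ∃ S : Finset ℕ, S ⊆ Finset.univ.sup B ∧ S.card = s ∧
      ∀ X : Finset ℕ, X ⊆ S → X.Nonempty →
        ∃ C ∈ (((Finset.univ : Finset (Fin l)).powerset.filter Finset.Nonempty).image
          fun I => I.sup B), C ∩ S = X := by
  classical
  -- a subfamily of minimum size covering everything
  obtain ⟨J, hJ, hmin⟩ := Finset.exists_min_image
    ((Finset.univ : Finset (Finset (Fin l))).filter fun J => J.sup B = Finset.univ.sup B)
    Finset.card ⟨Finset.univ, by simp⟩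
  have hJT : J.sup B = Finset.univ.sup B := (Finset.mem_filter.1 hJ).2
  -- it has at least s members
  have hcard : s ≤ J.card := by
    have h1 : (J.sup B).card ≤ J.card * k := by
      rw [Finset.sup_eq_biUnion]
      exact Finset.card_biUnion_le_card_mul _ _ _ (fun i _ => hB i)
    rw [hJT] at h1
    exact Nat.le_of_mul_le_mul_right (hT.trans h1) hk
  -- each member has a private element
  have hpriv : ∀ i : Fin l, ∃ x, i ∈ J → x ∈ B i ∧ ∀ j ∈ J, x ∈ B j → j = i := by
    intro i
    by_cases hi : i ∈ J
    · by_contra hcon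
      push Not at hcon
      have hsup : (J.erase i).sup B = Finset.univ.sup B := by
        rw [← hJT]
        apply le_antisymm (Finset.sup_mono (Finset.erase_subset _ _))
        intro x hx
        obtain ⟨j, hj, hxj⟩ := Finset.mem_sup.1 hx
        by_cases hji : j = i
        · subst hji
          obtain ⟨m, hm, hxm, hne⟩ := (hcon x).2 hxj
          exact Finset.mem_sup.2 ⟨m, Finset.mem_erase.2 ⟨hne, hm⟩, hxm⟩
        · exact Finset.mem_sup.2 ⟨j, Finset.mem_erase.2 ⟨hji, hj⟩, hxj⟩
      have h2 := hmin (J.erase i) (by simp [hsup])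
      have h3 := Finset.card_erase_lt_of_mem hi
      omega
    · exact ⟨0, fun h => absurd h hi⟩
  choose f hf using hpriv
  obtain ⟨K, hKJ, hKs⟩ := Finset.exists_subset_card_eq hcard
  refine ⟨K.image f, ?_, ?_, ?_⟩
  · intro x hx
    obtain ⟨i, hi, rfl⟩ := Finset.mem_image.1 hx
    exact Finset.mem_sup.2 ⟨i, Finset.mem_univ _, (hf i (hKJ hi)).1⟩
  · rw [Finset.card_image_of_injOn, hKs]
    intro i hi j hj hij
    have hi' := hKJ hi
    have hj' := hKJ hj
    exact (hf j hj').2 i hi' (hij ▸ (hf i hi').1)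
  · intro X hX hne
    refine ⟨(K.filter fun i => f i ∈ X).sup B, ?_, ?_⟩
    · refine Finset.mem_image.2 ⟨_, Finset.mem_filter.2 ⟨by simp, ?_⟩, rfl⟩
      obtain ⟨x, hx⟩ := hne
      obtain ⟨i, hi, rfl⟩ := Finset.mem_image.1 (hX hx)
      exact ⟨i, Finset.mem_filter.2 ⟨hi, hx⟩⟩
    · ext x
      constructor
      · intro h
        obtain ⟨h1, h2⟩ := Finset.mem_inter.1 h
        obtain ⟨i, hi, rfl⟩ := Finset.mem_image.1 h2
        obtain ⟨j, hj, hxj⟩ := Finset.mem_sup.1 h1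
        obtain ⟨hjK, hjX⟩ := Finset.mem_filter.1 hj
        have := (hf i (hKJ hi)).2 j (hKJ hjK) hxj
        exact this ▸ hjX
      · intro hx
        refine Finset.mem_inter.2 ⟨?_, hX hx⟩
        obtain ⟨i, hi, rfl⟩ := Finset.mem_image.1 (hX hx)
        exact Finset.mem_sup.2 ⟨i, Finset.mem_filter.2 ⟨hi, hx⟩, (hf i (hKJ hi)).1⟩
end

section
/- Let k ≥ 2 and let 𝒜 = {A_1,…,A_n} be a family of distinct k-element subsets of ℕ with ground set G = A_1 ∪ … ∪ A_n. Fix x ∈ G, let d_x = |{ i : x ∈ A_i }|, and let 𝒜_x = { A ⊆ G : x ∈ A, |A| ≥ k, and for every i with x ∈ A_i we have A_i ⊄ A }. If s is a positive integer with d_x ≥ s·(|G| choose k−2), then |𝒜_x| ≤ 2^{|G| − s}. -/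
theorem choose_bound_aux (m r : ℕ) (hr : 1 ≤ r) (t : ℕ) :
    m.choose r ≤ (m - t).choose r + t * (m + 1).choose (r - 1) := by
  induction t with
  | zero => simp
  | succ t ih =>
    have h : (m - t).choose r ≤ (m - (t + 1)).choose r + (m + 1).choose (r - 1) := by
      rcases Nat.eq_zero_or_pos (m - t) with h0 | h0
      · have : m - (t + 1) = 0 := by omega
        rw [h0, this]; exact Nat.le_add_right _ _
      · obtain ⟨q, hq⟩ : ∃ q, m - t = q + 1 := ⟨m - t - 1, by omega⟩
        obtain ⟨p, rfl⟩ : ∃ p, r = p + 1 := ⟨r - 1, by omega⟩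
        have h1 : m - (t + 1) = q := by omega
        rw [hq, h1, Nat.choose_succ_succ]
        have : q.choose p ≤ (m + 1).choose p := Nat.choose_le_choose _ (by omega)
        simp only [Nat.add_sub_cancel, Nat.succ_eq_add_one]
        omega
    rw [Nat.succ_mul]
    omega

theorem kk_aux (H : Finset ℕ) (B : Finset (Finset ℕ)) (r j M : ℕ) (hrj : r ≤ j) (hjM : j ≤ M)
    (hM : M ≤ H.card) (hBH : ∀ b ∈ B, b ⊆ H) (hBj : ∀ b ∈ B, b.card = j)
    (hB : M.choose j ≤ B.card) :
    M.choose r ≤ ((H.powersetCard r).filter fun T => ∃ b ∈ B, T ⊆ b).card := by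
  classical
  let e : Fin H.card ↪ ℕ := (H.orderEmbOfFin rfl).toEmbedding
  have he : ∀ i, e i ∈ H := fun i => H.orderEmbOfFin_mem rfl i
  have hsurj : ∀ y ∈ H, ∃ i, e i = y := by
    intro y hy
    have := H.range_orderEmbOfFin rfl
    have h2 : y ∈ Set.range (H.orderEmbOfFin rfl) := by rw [this]; exact hy
    exact h2
  let B' : Finset (Finset (Fin H.card)) := Finset.univ.filter fun S => S.map e ∈ B
  have hB' : B.card ≤ B'.card := by
    refine le_trans (Finset.card_le_card ?_) (Finset.card_image_le (s := B') (f := fun S => S.map e))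
    intro b hb
    rw [Finset.mem_image]
    have : (Finset.univ.filter fun i => e i ∈ b).map e = b := by
      ext y
      simp only [Finset.mem_map, Finset.mem_filter, Finset.mem_univ, true_and]
      constructor
      · rintro ⟨i, hi, rfl⟩; exact hi
      · intro hy
        obtain ⟨i, rfl⟩ := hsurj y (hBH b hb hy)
        exact ⟨i, hy, rfl⟩
    refine ⟨Finset.univ.filter fun i => e i ∈ b, ?_, this⟩
    simp only [B', Finset.mem_filter, Finset.mem_univ, true_and]
    rw [this]; exact hb
  have hsz : (B' : Set (Finset (Fin H.card))).Sized j := by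
    intro S hS
    have hS' : S.map e ∈ B := by simpa [B'] using hS
    simpa using hBj _ hS'
  have key := Finset.kruskal_katona_lovasz_form (i := j - r) (Nat.sub_le j r) hjM hM hsz
    (hB.trans hB')
  rw [Nat.sub_sub_self hrj] at key
  refine key.trans ?_
  refine Finset.card_le_card_of_injOn (fun S => S.map e) ?_
    (fun a _ b _ h => Finset.map_injective e h)
  intro T hT
  have hT' := Finset.mem_coe.1 hT
  rw [Finset.mem_shadow_iterate_iff_exists_mem_card_add] at hT'
  obtain ⟨S, hS, hTS, hc⟩ := hT'
  have hSj := hsz hS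
  have hS' : S.map e ∈ B := by simpa [B'] using hS
  simp only [Finset.coe_filter, Set.mem_setOf_eq, Finset.mem_powersetCard, Finset.card_map]
  refine ⟨⟨?_, by omega⟩, S.map e, hS', Finset.map_subset_map.2 hTS⟩
  intro y hy
  obtain ⟨i, _, rfl⟩ := Finset.mem_map.1 hy
  exact he i

theorem stmt4 (k : ℕ) (hk : 2 ≤ k) (A : Finset (Finset ℕ))
    (hA : ∀ S ∈ A, S.card = k) (x : ℕ) (hx : x ∈ A.sup id)
    (s : ℕ) (hs : 0 < s)
    (hd : s * (A.sup id).card.choose (k - 2) ≤ (A.filter fun Ai => x ∈ Ai).card) :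
    (((A.sup id).powerset.filter fun S => x ∈ S ∧ k ≤ S.card ∧
        ∀ Ai ∈ A, x ∈ Ai → ¬ Ai ⊆ S).card) ≤ 2 ^ ((A.sup id).card - s) := by
  classical
  have hsub : ∀ S ∈ A, S ⊆ A.sup id := fun S hS => Finset.le_sup (f := id) hS
  have hkG : k ≤ (A.sup id).card := by
    obtain ⟨S, hS, _⟩ := Finset.mem_sup.1 hx
    rw [← hA S hS]; exact Finset.card_le_card (hsub S hS)
  generalize hG : A.sup id = G at *
  obtain ⟨r, rfl⟩ : ∃ r, k = r + 1 := ⟨k - 1, by omega⟩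
  have hH : (G.erase x).card + 1 = G.card := Finset.card_erase_add_one hx
  set H := G.erase x with hHdef
  set F := G.powerset.filter fun S => x ∈ S ∧ r + 1 ≤ S.card ∧
        ∀ Ai ∈ A, x ∈ Ai → ¬ Ai ⊆ S with hF
  set M := G.card - s with hMdef
  -- arithmetic
  have harith : H.card.choose r < M.choose r + (A.filter fun Ai => x ∈ Ai).card := by
    have h1 := choose_bound_aux H.card r (by omega) (s - 1)
    have h2 : H.card - (s - 1) = M := by omega
    have h3 : 0 < (H.card + 1).choose (r - 1) := Nat.choose_pos (by omega)
    have h4 : r + 1 - 2 = r - 1 := by omega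
    rw [h4, ← hH] at hd
    obtain ⟨t, rfl⟩ : ∃ t, s = t + 1 := ⟨s - 1, by omega⟩
    rw [h2] at h1
    rw [Nat.succ_mul] at hd
    simp only [Nat.add_sub_cancel] at h1
    omega
  -- families of independent sets have few r-subsets
  have hind : ∀ B : Finset (Finset ℕ), (∀ b ∈ B, insert x b ∈ F) →
      ((H.powersetCard r).filter fun T => ∃ b ∈ B, T ⊆ b).card < M.choose r := by
    intro B hB
    set L := (A.filter fun Ai => x ∈ Ai).image fun S => S.erase x with hL
    have hLc : L.card = (A.filter fun Ai => x ∈ Ai).card := by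
      refine Finset.card_image_of_injOn ?_
      intro a ha b hb h
      have ha' := (Finset.mem_filter.1 (Finset.mem_coe.1 ha)).2
      have hb' := (Finset.mem_filter.1 (Finset.mem_coe.1 hb)).2
      have h' : a.erase x = b.erase x := h
      rw [← Finset.insert_erase ha', h', Finset.insert_erase hb']
    have hdisj : Disjoint ((H.powersetCard r).filter fun T => ∃ b ∈ B, T ⊆ b) L := by
      rw [Finset.disjoint_left]
      intro T hT hTL
      obtain ⟨_, b, hb, hTb⟩ := Finset.mem_filter.1 hT
      obtain ⟨S, hS, rfl⟩ := Finset.mem_image.1 hTL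
      obtain ⟨hSA, hxS⟩ := Finset.mem_filter.1 hS
      have := (Finset.mem_filter.1 (hB b hb)).2.2.2 S hSA hxS
      exact this (Finset.subset_insert_iff.2 hTb)
    have hun : ((H.powersetCard r).filter fun T => ∃ b ∈ B, T ⊆ b) ∪ L ⊆ H.powersetCard r := by
      refine Finset.union_subset (Finset.filter_subset _ _) ?_
      intro T hT
      obtain ⟨S, hS, rfl⟩ := Finset.mem_image.1 hT
      obtain ⟨hSA, hxS⟩ := Finset.mem_filter.1 hS
      rw [Finset.mem_powersetCard]
      refine ⟨Finset.erase_subset_erase x (hsub S hSA), ?_⟩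
      rw [Finset.card_erase_of_mem hxS, hA S hSA]; rfl
    have := Finset.card_le_card hun
    rw [Finset.card_union_of_disjoint hdisj, Finset.card_powersetCard, hLc] at this
    omega
  -- level bound
  let Fj : ℕ → Finset (Finset ℕ) := fun j => (F.image fun S => S.erase x).filter fun T => T.card = j
  have hFmem : ∀ j, ∀ b ∈ Fj j, insert x b ∈ F ∧ b.card = j ∧ b ⊆ H ∧ r ≤ j := by
    intro j b hb
    obtain ⟨hb1, hb2⟩ := Finset.mem_filter.1 hb
    obtain ⟨S, hS, rfl⟩ := Finset.mem_image.1 hb1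
    obtain ⟨hSG, hxS, hc, _⟩ := Finset.mem_filter.1 hS
    refine ⟨by rwa [Finset.insert_erase hxS], hb2,
      Finset.erase_subset_erase x (Finset.mem_powerset.1 hSG), ?_⟩
    have := Finset.card_erase_add_one hxS
    omega
  have hMH : M ≤ H.card := by omega
  have hsmall : ∀ j, ∀ b ∈ Fj j, j ≤ M := by
    intro j b hb
    by_contra hlt
    obtain ⟨h1, h2, h3, h4⟩ := hFmem j b hb
    have ha := hind {b} (by simpa using h1)
    have hb' := kk_aux H {b} r j j h4 le_rfl (h2 ▸ Finset.card_le_card h3) (by simpa using h3)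
      (by simpa using h2) (by simp)
    have := Nat.choose_le_choose (a := M) (b := j) r (by omega)
    omega
  have hlevel : ∀ j, (Fj j).card ≤ M.choose j := by
    intro j
    rcases (Fj j).eq_empty_or_nonempty with h0 | ⟨b, hb⟩
    · simp [h0]
    · by_contra hlt
      have ha := hind (Fj j) (fun b hb => (hFmem j b hb).1)
      have hb' := kk_aux H (Fj j) r j M (hFmem j b hb).2.2.2 (hsmall j b hb) hMH
        (fun b hb => (hFmem j b hb).2.2.1) (fun b hb => (hFmem j b hb).2.1) (by omega)
      omega
  have hFc : (F.image fun S => S.erase x).card = F.card := by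
    refine Finset.card_image_of_injOn ?_
    intro a ha b hb h
    have ha' := (Finset.mem_filter.1 (Finset.mem_coe.1 ha)).2.1
    have hb' := (Finset.mem_filter.1 (Finset.mem_coe.1 hb)).2.1
    have h' : a.erase x = b.erase x := h
    rw [← Finset.insert_erase ha', h', Finset.insert_erase hb']
  rw [← hFc, ← Nat.sum_range_choose,
    Finset.card_eq_sum_card_fiberwise (f := Finset.card) (t := Finset.range (M + 1)) ?_]
  · exact Finset.sum_le_sum fun j _ => hlevel j
  · intro b hb
    have : b ∈ Fj b.card := Finset.mem_filter.2 ⟨hb, rfl⟩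
    have := hsmall _ b this
    simp only [Finset.coe_range, Set.mem_Iio]
    omega
end

section
/- Let ℋ be a finite nonempty family of finite subsets of ℕ and let A be a finite subset of ℕ such that A is not contained in ∪_{S ∈ ℋ} S. Then |ℋ ∪ { A ∪ S : S ∈ ℋ }| ≥ (1 + 1/2^{|A|−1}) · |ℋ|. -/
theorem stmt5 (H : Finset (Finset ℕ)) (hH : H.Nonempty) (A : Finset ℕ)
    (hA : ¬ A ⊆ H.sup id) :
    (1 + 1 / 2 ^ (A.card - 1)) * (H.card : ℝ) ≤
      (((H ∪ H.image fun S => A ∪ S).card : ℝ)) := by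
  obtain ⟨a, haA, ha⟩ := Finset.not_subset.mp hA
  have hn : ∀ S ∈ H, a ∉ S := fun S hS h => ha (Finset.mem_sup.mpr ⟨S, hS, h⟩)
  have hd : Disjoint H (H.image fun S => A ∪ S) := by
    rw [Finset.disjoint_left]
    intro S hS hS'
    obtain ⟨T, _, rfl⟩ := Finset.mem_image.mp hS'
    exact hn _ hS (Finset.mem_union_left _ haA)
  have hc : H.card ≤ (H.image fun S => A ∪ S).card * 2 ^ (A.card - 1) := by
    rw [← Finset.card_erase_of_mem haA, ← Finset.card_powerset, ← Finset.card_product]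
    apply Finset.card_le_card_of_injOn (fun S => (A ∪ S, S ∩ A))
    · intro S hS
      simp only [Finset.coe_product, Set.mem_prod, Finset.mem_coe, Finset.mem_powerset]
      refine ⟨Finset.mem_image_of_mem _ hS, fun x hx => ?_⟩
      rw [Finset.mem_inter] at hx
      refine Finset.mem_erase.mpr ⟨?_, hx.2⟩
      rintro rfl
      exact hn S hS hx.1
    · intro S _ T _ h
      simp only [Prod.mk.injEq, Finset.ext_iff, Finset.mem_union, Finset.mem_inter] at h
      ext x
      have h1 := h.1 x
      have h2 := h.2 x
      tauto
  rw [Finset.card_union_of_disjoint hd]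
  have hc' : (H.card : ℝ) ≤ (H.image fun S => A ∪ S).card * 2 ^ (A.card - 1) := by
    exact_mod_cast hc
  have := (div_le_iff₀ (by positivity : (0 : ℝ) < 2 ^ (A.card - 1))).mpr hc'
  push_cast
  rw [add_mul, one_mul, one_div_mul_eq_div]
  linarith
end

section
/- Let k ≥ 2 and let l be a positive integer with l < k(k+1)/2. Let 𝒳 be a family of l distinct k-element subsets of ℕ, and let b be the number of (k+1)-element subsets C of ℕ with the property that at least k of the k-element subsets of C belong to 𝒳. Then l ≥ b·k − (b choose 2). -/
theorem inter_card_le_one (k : ℕ) (X : Finset (Finset ℕ)) (C D : Finset ℕ) (hC : C.card = k + 1)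
    (hD : D.card = k + 1) (h : C ≠ D) :
    ((Finset.powersetCard k C ∩ X) ∩ (Finset.powersetCard k D ∩ X)).card ≤ 1 := by
  have hlt : (C ∩ D).card ≤ k := by
    by_contra hc
    have h1 : C ∩ D = C := Finset.eq_of_subset_of_card_le Finset.inter_subset_left (by omega)
    have h2 : C ∩ D = D := Finset.eq_of_subset_of_card_le Finset.inter_subset_right (by omega)
    exact h (h1.symm.trans h2)
  have key : ∀ S ∈ (Finset.powersetCard k C ∩ X) ∩ (Finset.powersetCard k D ∩ X),
      S = C ∩ D := by
    intro S hS
    simp only [Finset.mem_inter, Finset.mem_powersetCard] at hS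
    obtain ⟨⟨⟨a, b⟩, _⟩, ⟨c, _⟩, _⟩ := hS
    exact Finset.eq_of_subset_of_card_le (Finset.subset_inter a c) (by omega)
  rw [Finset.card_le_one]
  intro a ha b hb
  rw [key a ha, key b hb]

theorem union_bound (k : ℕ) (X : Finset (Finset ℕ)) (T : Finset (Finset ℕ)) :
    (∀ C ∈ T, C.card = k + 1 ∧ k ≤ (Finset.powersetCard k C ∩ X).card) →
    (T.card : ℤ) * k - (T.card.choose 2 : ℤ) ≤
      ((T.biUnion fun C => Finset.powersetCard k C ∩ X).card : ℤ) := by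
  induction T using Finset.induction_on with
  | empty => intro _; simp
  | insert C T hCT ih =>
    intro hT
    have ih' := ih fun D hD => hT D (Finset.mem_insert_of_mem hD)
    obtain ⟨hC, hCk⟩ := hT C (Finset.mem_insert_self C T)
    rw [Finset.biUnion_insert, Finset.card_insert_of_notMem hCT]
    have h1 := Finset.card_union_add_card_inter (Finset.powersetCard k C ∩ X)
      (T.biUnion fun C => Finset.powersetCard k C ∩ X)
    have h2 : ((Finset.powersetCard k C ∩ X) ∩
        (T.biUnion fun C => Finset.powersetCard k C ∩ X)).card ≤ T.card := by
      rw [Finset.inter_biUnion]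
      have := Finset.card_biUnion_le_card_mul T
        (fun D => (Finset.powersetCard k C ∩ X) ∩ (Finset.powersetCard k D ∩ X)) 1
        (fun D hD => inter_card_le_one k X C D hC (hT D (Finset.mem_insert_of_mem hD)).1
          (fun e => hCT (e ▸ hD)))
      simpa using this
    have h3 : (T.card + 1).choose 2 = T.card + T.card.choose 2 := by
      rw [Nat.choose_succ_succ' T.card 1, Nat.choose_one_right]
    rw [h3]
    push_cast
    zify at h1 h2 hCk
    linarith

theorem stmt8 (k l : ℕ) (hk : 2 ≤ k) (hl : 0 < l) (hl2 : l < k * (k + 1) / 2)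
    (X : Finset (Finset ℕ)) (hXk : ∀ S ∈ X, S.card = k) (hXl : X.card = l) :
    ∀ b : ℕ,
      b = ((Finset.powersetCard (k + 1) (X.sup id)).filter fun C =>
        k ≤ (Finset.powersetCard k C ∩ X).card).card →
      (b : ℤ) * k - (b.choose 2 : ℤ) ≤ (l : ℤ) := by
  intro b hb
  subst hb
  refine (union_bound k X _ ?_).trans ?_
  · intro C hC
    rw [Finset.mem_filter, Finset.mem_powersetCard] at hC
    exact ⟨hC.1.2, hC.2⟩
  · rw [← hXl]
    exact_mod_cast Finset.card_le_card
      (Finset.biUnion_subset.2 fun C _ => Finset.inter_subset_right)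
end

section
/- For every integer k ≥ 2 and every positive integer l there exists t_0 (depending on k and l) such that for all t > t_0 the following holds. Let n = (t choose k) + l and let 𝒞 = [t]^(k) ∪ {Y_1,…,Y_l}, where Y_i = {1,2,…,k−2} ∪ {k−2+i} ∪ {t+1} for 1 ≤ i ≤ l. Then for every family 𝒜 of n distinct k-element subsets of ℕ, |⟨𝒜⟩| ≥ |⟨𝒞⟩|. -/
/-- The union-closed family generated by a finite family `A` of finite subsets of `ℕ`:
all unions of nonempty subfamilies of `A`. -/
def unionClosure (A : Finset (Finset ℕ)) : Finset (Finset ℕ) :=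
  (A.powerset.filter Finset.Nonempty).image fun B => B.sup id


section helpers
open scoped Classical
open Finset

/-- Every point of `X` lies in a member of `A` contained in `X`. -/
def Cov (A : Finset (Finset ℕ)) (X : Finset ℕ) : Prop := ∀ x ∈ X, ∃ e ∈ A, x ∈ e ∧ e ⊆ X

lemma mem_uc {A : Finset (Finset ℕ)} (hA : ∀ e ∈ A, e.Nonempty) (X : Finset ℕ) :
    X ∈ unionClosure A ↔ X.Nonempty ∧ Cov A X := by
  simp only [unionClosure, Finset.mem_image, Finset.mem_filter, Finset.mem_powerset]
  constructor
  · rintro ⟨B, ⟨hB, ⟨b, hb⟩⟩, rfl⟩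
    have hsub : ∀ e ∈ B, e ⊆ B.sup id := fun e he => Finset.le_sup (f := id) he
    refine ⟨(hA b (hB hb)).mono (hsub b hb), ?_⟩
    intro x hx
    rw [Finset.mem_sup] at hx
    obtain ⟨e, he, hxe⟩ := hx
    exact ⟨e, hB he, hxe, hsub e he⟩
  · rintro ⟨⟨x, hx⟩, hc⟩
    refine ⟨A.filter (fun e => e ⊆ X), ⟨Finset.filter_subset _ _, ?_⟩, ?_⟩
    · obtain ⟨e, he, -, h⟩ := hc x hx
      exact ⟨e, by simp [he, h]⟩
    · ext y
      rw [Finset.mem_sup]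
      constructor
      · rintro ⟨e, he, hy⟩
        exact (Finset.mem_filter.1 he).2 hy
      · intro hy
        obtain ⟨e, he, hye, h⟩ := hc y hy
        exact ⟨e, by simp [he, h], hye⟩

lemma card_le_uc {A : Finset (Finset ℕ)} (hA : ∀ e ∈ A, e.Nonempty) (F : Finset (Finset ℕ))
    (hF : ∀ X ∈ F, Cov A X) : F.card ≤ (unionClosure A).card + 1 := by
  have : F ⊆ insert ∅ (unionClosure A) := by
    intro X hX
    rw [Finset.mem_insert, mem_uc hA]
    rcases X.eq_empty_or_nonempty with h | h
    · exact Or.inl h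
    · exact Or.inr ⟨h, hF X hX⟩
  exact (Finset.card_le_card this).trans (Finset.card_insert_le _ _)

lemma card_le_uc' {A : Finset (Finset ℕ)} (hA : ∀ e ∈ A, e.Nonempty) (F : Finset (Finset ℕ))
    (hF : ∀ X ∈ F, X.Nonempty ∧ Cov A X) : F.card ≤ (unionClosure A).card :=
  Finset.card_le_card fun X hX => (mem_uc hA X).2 (hF X hX)

/-- All sets `e ∪ S` with `e ∈ E`, `S ⊆ T`. -/
def Pup (T : Finset ℕ) (E : Finset (Finset ℕ)) : Finset (Finset ℕ) :=
  (E ×ˢ T.powerset).image (fun p => p.1 ∪ p.2)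

lemma mem_Pup {T : Finset ℕ} {E : Finset (Finset ℕ)} {X : Finset ℕ} :
    X ∈ Pup T E ↔ ∃ e ∈ E, ∃ S, S ⊆ T ∧ e ∪ S = X := by
  simp only [Pup, Finset.mem_image, Finset.mem_product, Finset.mem_powerset, Prod.exists]
  constructor
  · rintro ⟨e, S, ⟨he, hS⟩, h⟩
    exact ⟨e, he, S, hS, h⟩
  · rintro ⟨e, he, S, hS, h⟩
    exact ⟨e, S, ⟨he, hS⟩, h⟩

lemma card_Pup_disj {T : Finset ℕ} {E : Finset (Finset ℕ)} (h : ∀ e ∈ E, e ∩ T = ∅) :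
    (Pup T E).card = E.card * 2 ^ T.card := by
  unfold Pup
  rw [Finset.card_image_of_injOn, Finset.card_product, Finset.card_powerset]
  rintro ⟨e, S⟩ h1 ⟨e', S'⟩ h2 heq
  simp only [Finset.coe_product, Set.mem_prod, Finset.mem_coe, Finset.mem_powerset] at h1 h2
  simp only at heq
  have he := h e h1.1
  have he' := h e' h2.1
  have d : ∀ x, x ∈ e → x ∉ T := fun x hx ht => by
    have : x ∈ e ∩ T := Finset.mem_inter.2 ⟨hx, ht⟩
    simp [he] at this
  have d' : ∀ x, x ∈ e' → x ∉ T := fun x hx ht => by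
    have : x ∈ e' ∩ T := Finset.mem_inter.2 ⟨hx, ht⟩
    simp [he'] at this
  have key : ∀ x, (x ∈ e ∨ x ∈ S) ↔ (x ∈ e' ∨ x ∈ S') := fun x => by
    rw [← Finset.mem_union, ← Finset.mem_union, heq]
  have s1 := h1.2
  have s2 := h2.2
  ext x
  · have := key x; have := d x; have := d' x; have := @s1 x; have := @s2 x; tauto
  · have := key x; have := d x; have := d' x; have := @s1 x; have := @s2 x; tauto

lemma card_Pup (T : Finset ℕ) : ∀ (r : ℕ) (E : Finset (Finset ℕ)),
    (∀ e ∈ E, (e ∩ T).card ≤ r + 1) →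
    2 ^ T.card * 2 ^ E.card ≤ (Pup T E).card * 2 ^ r * 2 ^ E.card + 2 ^ T.card := by
  induction T using Finset.induction_on with
  | empty =>
    intro r E _
    rw [card_Pup_disj (by simp)]
    simp only [card_empty, pow_zero, mul_one, one_mul]
    rcases Nat.eq_zero_or_pos E.card with h | h
    · simp [h]
    · have : 1 ≤ E.card * 2 ^ r := Nat.mul_pos h (by positivity)
      nlinarith [Nat.one_le_two_pow (n := E.card)]
  | insert x T hx ih =>
    intro r E hE
    set E0 := E.filter (fun e => x ∉ e) with hE0
    set E1 := (E.filter (fun e => x ∈ e)).image (fun e => e.erase x) with hE1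
    have c1 : E1.card = (E.filter (fun e => x ∈ e)).card := by
      apply Finset.card_image_of_injOn
      intro a ha b hb hab
      simp only [Finset.coe_filter, Set.mem_ofPred_eq] at ha hb
      simp only at hab
      rw [← Finset.insert_erase ha.2, hab, Finset.insert_erase hb.2]
    have csum : E1.card + E0.card = E.card := by
      rw [c1]; exact Finset.card_filter_add_card_filter_not _
    have hE0' : ∀ e ∈ E0, (e ∩ T).card ≤ r + 1 := by
      intro e he
      refine (Finset.card_le_card ?_).trans (hE e (Finset.mem_filter.1 he).1)
      exact Finset.inter_subset_inter_left (Finset.subset_insert _ _)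
    have hE1' : ∀ e ∈ E1, (e ∩ T).card ≤ r := by
      intro e he
      obtain ⟨f, hf, rfl⟩ := Finset.mem_image.1 he
      rw [Finset.mem_filter] at hf
      have h1 := hE f hf.1
      have h2 : insert x (f.erase x ∩ T) ⊆ f ∩ insert x T := by
        intro y hy
        simp only [Finset.mem_insert, Finset.mem_inter, Finset.mem_erase] at hy ⊢
        rcases hy with rfl | hy
        · exact ⟨hf.2, Or.inl rfl⟩
        · exact ⟨hy.1.2, Or.inr hy.2⟩
      have h3 := Finset.card_le_card h2
      rw [Finset.card_insert_of_notMem (by simp)] at h3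
      omega
    have nx0 : ∀ X ∈ Pup T E0, x ∉ X := by
      intro X hX
      obtain ⟨e, he, S, hS, rfl⟩ := mem_Pup.1 hX
      rw [Finset.mem_union, not_or]
      exact ⟨(Finset.mem_filter.1 he).2, fun h => hx (hS h)⟩
    have nx1 : ∀ X ∈ Pup T E1, x ∉ X := by
      intro X hX
      obtain ⟨e, he, S, hS, rfl⟩ := mem_Pup.1 hX
      obtain ⟨f, hf, rfl⟩ := Finset.mem_image.1 he
      rw [Finset.mem_union, not_or]
      exact ⟨by simp, fun h => hx (hS h)⟩
    have gen : ∀ Q : Finset (Finset ℕ), (∀ X ∈ Q, x ∉ X ∧ insert x X ∈ Pup (insert x T) E) →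
        (Pup T E0).card + Q.card ≤ (Pup (insert x T) E).card := by
      intro Q hQ
      have ci : (Q.image (fun X => insert x X)).card = Q.card := by
        apply Finset.card_image_of_injOn
        intro a ha b hb hab
        simp only at hab
        rw [← Finset.erase_insert (hQ a ha).1, hab, Finset.erase_insert (hQ b hb).1]
      rw [← ci, ← Finset.card_union_of_disjoint]
      · apply Finset.card_le_card
        intro X hX
        rcases Finset.mem_union.1 hX with h | h
        · obtain ⟨e, he, S, hS, rfl⟩ := mem_Pup.1 h
          exact mem_Pup.2 ⟨e, (Finset.mem_filter.1 he).1, S,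
            hS.trans (Finset.subset_insert _ _), rfl⟩
        · obtain ⟨Y, hY, rfl⟩ := Finset.mem_image.1 h
          exact (hQ Y hY).2
      · rw [Finset.disjoint_left]
        intro X h1 h2
        obtain ⟨Y, hY, rfl⟩ := Finset.mem_image.1 h2
        exact nx0 _ h1 (Finset.mem_insert_self _ _)
    have IH0 := ih r E0 hE0'
    rw [Finset.card_insert_of_notMem hx]
    rcases Nat.eq_zero_or_pos E1.card with h0 | hpos
    · have g := gen (Pup T E0) (by
        intro X hX
        refine ⟨nx0 X hX, ?_⟩
        obtain ⟨e, he, S, hS, rfl⟩ := mem_Pup.1 hX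
        refine mem_Pup.2 ⟨e, (Finset.mem_filter.1 he).1, insert x S,
          Finset.insert_subset_insert _ hS, ?_⟩
        rw [Finset.union_insert])
      have : E0.card = E.card := by omega
      rw [this] at IH0
      rw [pow_succ]
      have h2 := Nat.mul_le_mul_right (2 ^ r * 2 ^ E.card) g
      nlinarith
    · have g := gen (Pup T E1) (by
        intro X hX
        refine ⟨nx1 X hX, ?_⟩
        obtain ⟨e, he, S, hS, rfl⟩ := mem_Pup.1 hX
        obtain ⟨f, hf, rfl⟩ := Finset.mem_image.1 he
        rw [Finset.mem_filter] at hf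
        refine mem_Pup.2 ⟨f, hf.1, S, hS.trans (Finset.subset_insert _ _), ?_⟩
        rw [← Finset.insert_union, Finset.insert_erase hf.2])
      rw [← csum, pow_add 2 E1.card, pow_succ 2 T.card]
      set p := (Pup (insert x T) E).card
      set p0 := (Pup T E0).card
      set p1 := (Pup T E1).card with hp1
      set N := 2 ^ T.card
      set X := 2 ^ E0.card with hX
      have hX1 : 1 ≤ X := Nat.one_le_two_pow
      have hY2 : 2 ≤ 2 ^ E1.card := by
        calc 2 = 2 ^ 1 := rfl
          _ ≤ _ := Nat.pow_le_pow_right (by norm_num) hpos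
      rcases r with _ | r
      · have hc : p1 = E1.card * N := by
          rw [hp1, card_Pup_disj]
          intro e he
          exact Finset.card_eq_zero.1 (Nat.le_zero.1 (hE1' e he))
        simp only [pow_zero, mul_one] at IH0 ⊢
        by_cases h1 : E1.card = 1
        · rw [h1] at hc ⊢
          have := Nat.mul_le_mul_right (2 * X) g
          nlinarith
        · have h2 : 2 ≤ E1.card := by omega
          have h3 : 2 * N ≤ p := by nlinarith
          have := Nat.mul_le_mul_right (2 ^ E1.card * X) h3
          nlinarith
      · have IH1 := ih r E1 hE1'
        set Y := 2 ^ E1.card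
        have e1 := Nat.mul_le_mul_right Y IH0
        have e2 := Nat.mul_le_mul_right (2 * X) IH1
        have e3 := Nat.mul_le_mul_right (2 ^ (r + 1) * (X * Y)) g
        have e4 : Y + 2 * X ≤ X * Y + 2 := by
          obtain ⟨a, ha⟩ := Nat.exists_eq_add_of_le hX1
          obtain ⟨b, hb⟩ := Nat.exists_eq_add_of_le hY2
          rw [ha, hb]; nlinarith [Nat.zero_le (a*b)]
        have e5 := Nat.mul_le_mul_left N e4
        have e6 : p1 * 2 ^ r * Y * (2 * X) = p1 * (2 ^ (r+1) * (X * Y)) := by ring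
        have e7 : N * Y * (2 * X) = 2 * (N * (X * Y)) := by ring
        nlinarith

lemma avoid_bound (j m : ℕ) (hj : 1 ≤ j) (hm : 1 ≤ m) : ∀ (M : ℕ) (G : Finset ℕ)
    (L : Finset (Finset ℕ)), (∀ e ∈ L, e.card = j ∧ e ⊆ G) → G.card ≤ m →
    M * (j * m ^ (j - 1)) ≤ L.card →
    (G.powerset.filter (fun S => ∀ e ∈ L, ¬ e ⊆ S)).card * (2 ^ j) ^ M ≤
      (2 ^ j - 1) ^ M * 2 ^ G.card := by
  intro M
  induction M with
  | zero =>
    intro G L _ _ _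
    simp only [pow_zero, mul_one, one_mul]
    rw [← Finset.card_powerset]
    exact Finset.card_filter_le _ _
  | succ M ih =>
    intro G L hL hG hc
    have hpos : 0 < j * m ^ (j - 1) := by positivity
    have : 0 < L.card := lt_of_lt_of_le (by positivity) hc
    obtain ⟨e, he⟩ := Finset.card_pos.1 this
    set L' := L.filter (fun f => Disjoint e f) with hL'
    set G' := G \ e
    have hsplit : L.card ≤ L'.card + j * m ^ (j - 1) := by
      rw [← Finset.card_filter_add_card_filter_not (s := L) (fun f => Disjoint e f)]
      gcongr
      have hs : L.filter (fun f => ¬ Disjoint e f) ⊆ e.biUnion (fun x => L.filter (fun f => x ∈ f)) := by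
        intro f hf
        rw [Finset.mem_filter, Finset.not_disjoint_iff] at hf
        obtain ⟨hf, x, hx, hxf⟩ := hf
        exact Finset.mem_biUnion.2 ⟨x, hx, Finset.mem_filter.2 ⟨hf, hxf⟩⟩
      refine (Finset.card_le_card hs).trans ?_
      rw [← (hL e he).1]
      apply Finset.card_biUnion_le_card_mul
      intro x hx
      rw [(hL e he).1]
      have : (L.filter (fun f => x ∈ f)).card ≤ (Finset.powersetCard (j - 1) G).card := by
        apply Finset.card_le_card_of_injOn (fun f => f.erase x)
        · intro f hf
          rw [Finset.mem_coe, Finset.mem_filter] at hf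
          rw [Finset.mem_coe, Finset.mem_powersetCard, Finset.card_erase_of_mem hf.2, (hL f hf.1).1]
          exact ⟨(Finset.erase_subset _ _).trans (hL f hf.1).2, rfl⟩
        · intro a ha b hb hab
          simp only [Finset.coe_filter, Set.mem_ofPred_eq] at ha hb
          simp only at hab
          rw [← Finset.insert_erase ha.2, hab, Finset.insert_erase hb.2]
      rw [Finset.card_powersetCard] at this
      exact this.trans ((Nat.choose_le_pow _ _).trans (Nat.pow_le_pow_left hG _))
    have IH := ih G' L' (by
      intro f hf
      rw [Finset.mem_filter] at hf
      exact ⟨(hL f hf.1).1, Finset.subset_sdiff.2 ⟨(hL f hf.1).2, hf.2.symm⟩⟩)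
      ((Finset.card_le_card Finset.sdiff_subset).trans hG)
      (by have : (M + 1) * (j * m ^ (j - 1)) = M * (j * m ^ (j - 1)) + j * m ^ (j - 1) := by ring
          omega)
    have hcard : (G.powerset.filter (fun S => ∀ e ∈ L, ¬ e ⊆ S)).card ≤
        (2 ^ j - 1) * (G'.powerset.filter (fun S => ∀ e ∈ L', ¬ e ⊆ S)).card := by
      have h1 : ((e.powerset.erase e) ×ˢ (G'.powerset.filter (fun S => ∀ e ∈ L', ¬ e ⊆ S))).card =
        (2 ^ j - 1) * (G'.powerset.filter (fun S => ∀ e ∈ L', ¬ e ⊆ S)).card := by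
        rw [Finset.card_product, Finset.card_erase_of_mem (by simp), Finset.card_powerset,
          (hL e he).1]
      rw [← h1]
      apply Finset.card_le_card_of_injOn (fun S => (S ∩ e, S \ e))
      · intro S hS
        simp only [Finset.coe_filter, Finset.mem_powerset, Set.mem_ofPred_eq] at hS
        simp only [Finset.coe_product, Set.mem_prod, Finset.mem_coe, Finset.mem_erase,
          Finset.mem_powerset, Finset.mem_filter]
        refine ⟨⟨fun h => hS.2 e he (Finset.inter_eq_right.1 h), Finset.inter_subset_right⟩,
          Finset.sdiff_subset_sdiff hS.1 (subset_refl _), ?_⟩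
        intro f hf hfs
        exact hS.2 f (Finset.mem_filter.1 hf).1 (hfs.trans Finset.sdiff_subset)
      · intro a _ b _ hab
        simp only [Prod.mk.injEq] at hab
        ext y
        have h1 := congrArg (fun s => y ∈ s) hab.1
        have h2 := congrArg (fun s => y ∈ s) hab.2
        simp only [Finset.mem_inter, Finset.mem_sdiff, eq_iff_iff] at h1 h2
        tauto
    have hGc : G.card = j + G'.card := by
      have := Finset.card_sdiff_add_card_eq_card (hL e he).2
      rw [(hL e he).1] at this
      change (G').card + j = _ at this
      omega
    rw [hGc, pow_add 2 j, pow_succ _ M, pow_succ _ M]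
    calc _ ≤ (2 ^ j - 1) * (G'.powerset.filter (fun S => ∀ e ∈ L', ¬ e ⊆ S)).card * ((2 ^ j) ^ M * 2 ^ j) := by gcongr
      _ = (2 ^ j - 1) * 2 ^ j * ((G'.powerset.filter (fun S => ∀ e ∈ L', ¬ e ⊆ S)).card * (2 ^ j) ^ M) := by ring
      _ ≤ (2 ^ j - 1) * 2 ^ j * ((2 ^ j - 1) ^ M * 2 ^ G'.card) := by gcongr
      _ = _ := by ring

lemma bad_bound (k m M : ℕ) (hk : 2 ≤ k) (hm : 1 ≤ m) (A : Finset (Finset ℕ))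
    (hA : ∀ e ∈ A, e.card = k) (T : Finset ℕ) (hT : T.card ≤ m)
    (hdeg : ∀ v ∈ T, M * ((k - 1) * m ^ (k - 2)) ≤ (A.filter (fun e => v ∈ e ∧ e ⊆ T)).card) :
    (T.powerset.filter (fun S => ¬ Cov A S)).card * (2 ^ (k - 1)) ^ M ≤
      T.card * ((2 ^ (k - 1) - 1) ^ M * 2 ^ T.card) := by
  have hsub : T.powerset.filter (fun S => ¬ Cov A S) ⊆
      T.biUnion (fun v => T.powerset.filter (fun S => v ∈ S ∧ ∀ e ∈ A, v ∈ e → ¬ e ⊆ S)) := by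
    intro S hS
    rw [Finset.mem_filter, Finset.mem_powerset] at hS
    obtain ⟨hST, hS⟩ := hS
    unfold Cov at hS
    push Not at hS
    obtain ⟨v, hv, h⟩ := hS
    exact Finset.mem_biUnion.2 ⟨v, hST hv, Finset.mem_filter.2
      ⟨Finset.mem_powerset.2 hST, hv, h⟩⟩
  have h1 : (T.powerset.filter (fun S => ¬ Cov A S)).card ≤
      ∑ v ∈ T, (T.powerset.filter (fun S => v ∈ S ∧ ∀ e ∈ A, v ∈ e → ¬ e ⊆ S)).card :=
    (Finset.card_le_card hsub).trans Finset.card_biUnion_le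
  refine (Nat.mul_le_mul_right _ h1).trans ?_
  rw [Finset.sum_mul, ← smul_eq_mul T.card]
  apply Finset.sum_le_card_nsmul
  intro v hv
  set L := (A.filter (fun e => v ∈ e ∧ e ⊆ T)).image (fun e => e.erase v) with hL
  have cL : L.card = (A.filter (fun e => v ∈ e ∧ e ⊆ T)).card := by
    apply Finset.card_image_of_injOn
    intro a ha b hb hab
    simp only [Finset.coe_filter, Set.mem_ofPred_eq] at ha hb
    simp only at hab
    rw [← Finset.insert_erase ha.2.1, hab, Finset.insert_erase hb.2.1]
  have key := avoid_bound (k - 1) m (by omega) hm M (T.erase v) L (by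
    intro e he
    obtain ⟨f, hf, rfl⟩ := Finset.mem_image.1 he
    rw [Finset.mem_filter] at hf
    refine ⟨?_, Finset.erase_subset_erase _ hf.2.2⟩
    rw [Finset.card_erase_of_mem hf.2.1, hA f hf.1])
    ((Finset.card_le_card (Finset.erase_subset _ _)).trans hT)
    (by rw [cL]; exact hdeg v hv)
  have h2 : (T.powerset.filter (fun S => v ∈ S ∧ ∀ e ∈ A, v ∈ e → ¬ e ⊆ S)).card ≤
      ((T.erase v).powerset.filter (fun S => ∀ e ∈ L, ¬ e ⊆ S)).card := by
    apply Finset.card_le_card_of_injOn (fun S => S.erase v)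
    · intro S hS
      simp only [Finset.coe_filter, Set.mem_ofPred_eq, Finset.mem_powerset] at hS ⊢
      refine ⟨Finset.erase_subset_erase _ hS.1, ?_⟩
      intro e he hes
      obtain ⟨f, hf, rfl⟩ := Finset.mem_image.1 he
      rw [Finset.mem_filter] at hf
      apply hS.2.2 f hf.1 hf.2.1
      rw [← Finset.insert_erase hf.2.1, ← Finset.insert_erase hS.2.1]
      exact Finset.insert_subset_insert _ hes
    · intro a ha b hb hab
      simp only [Finset.coe_filter, Set.mem_ofPred_eq] at ha hb
      simp only at hab
      rw [← Finset.insert_erase ha.2.1, hab, Finset.insert_erase hb.2.1]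
  refine (Nat.mul_le_mul_right _ h2).trans (key.trans ?_)
  gcongr
  · norm_num
  · exact Finset.erase_subset _ _

lemma peel (A : Finset (Finset ℕ)) (G : Finset ℕ) (hG : ∀ e ∈ A, e ⊆ G) (D : ℕ) :
    ∃ T, T ⊆ G ∧ (∀ v ∈ T, D ≤ (A.filter (fun e => v ∈ e ∧ e ⊆ T)).card) ∧
      (A.filter (fun e => ¬ e ⊆ T)).card ≤ (G \ T).card * D := by
  have hne : (G.powerset.filter
      (fun T => (A.filter (fun e => ¬ e ⊆ T)).card ≤ (G \ T).card * D)).Nonempty := by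
    refine ⟨G, ?_⟩
    rw [Finset.mem_filter]
    refine ⟨by simp, ?_⟩
    rw [Finset.filter_false_of_mem]
    · simp
    · intro e he; exact not_not.2 (hG e he)
  obtain ⟨T, hT, hmin⟩ := Finset.exists_min_image _ (fun T => T.card) hne
  rw [Finset.mem_filter, Finset.mem_powerset] at hT
  refine ⟨T, hT.1, ?_, hT.2⟩
  intro v hv
  by_contra hlt
  push Not at hlt
  have h := hmin (T.erase v) (by
    rw [Finset.mem_filter, Finset.mem_powerset]
    refine ⟨(Finset.erase_subset _ _).trans hT.1, ?_⟩
    have h1 : A.filter (fun e => ¬ e ⊆ T.erase v) ⊆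
        A.filter (fun e => ¬ e ⊆ T) ∪ A.filter (fun e => v ∈ e ∧ e ⊆ T) := by
      intro e he
      simp only [Finset.mem_filter, Finset.mem_union, Finset.subset_erase] at he ⊢
      tauto
    have h2 : G \ T.erase v = insert v (G \ T) := by
      rw [Finset.sdiff_erase (hT.1 hv)]
    rw [h2, Finset.card_insert_of_notMem (by simp [hv])]
    refine (Finset.card_le_card h1).trans ((Finset.card_union_le _ _).trans ?_)
    have := hT.2
    nlinarith)
  have := Finset.card_erase_lt_of_mem hv
  omega

lemma exists_private (A : Finset (Finset ℕ)) (W : Finset ℕ) (hW : ∀ w ∈ W, ∃ e ∈ A, w ∈ e) :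
    ∃ E, E ⊆ A ∧ (∀ w ∈ W, ∃ e ∈ E, w ∈ e) ∧
      ∀ e ∈ E, ∃ w ∈ W, w ∈ e ∧ ∀ f ∈ E, w ∈ f → f = e := by
  obtain ⟨E, hE, hmin⟩ := Finset.exists_min_image
    (A.powerset.filter (fun E => ∀ w ∈ W, ∃ e ∈ E, w ∈ e)) (fun E => E.card)
    ⟨A, by simpa using hW⟩
  rw [Finset.mem_filter, Finset.mem_powerset] at hE
  refine ⟨E, hE.1, hE.2, ?_⟩
  intro e he
  by_contra hcon
  push Not at hcon
  have := hmin (E.erase e) (by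
    rw [Finset.mem_filter, Finset.mem_powerset]
    refine ⟨(Finset.erase_subset _ _).trans hE.1, ?_⟩
    intro w hw
    obtain ⟨f, hf, hwf⟩ := hE.2 w hw
    by_cases hfe : f = e
    · subst hfe
      obtain ⟨g, hg, hwg, hne⟩ := hcon w hw hwf
      exact ⟨g, Finset.mem_erase.2 ⟨hne, hg⟩, hwg⟩
    · exact ⟨f, Finset.mem_erase.2 ⟨hfe, hf⟩, hwf⟩)
  have := Finset.card_erase_lt_of_mem he
  omega

lemma Cov.union_family {A : Finset (Finset ℕ)} {S : Finset ℕ} (hS : Cov A S)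
    {I : Finset (Finset ℕ)} (hI : I ⊆ A) : Cov A (S ∪ I.sup id) := by
  intro x hx
  rw [Finset.mem_union, Finset.mem_sup] at hx
  rcases hx with hx | ⟨e, he, hx⟩
  · obtain ⟨e, he, hxe, hes⟩ := hS x hx
    exact ⟨e, he, hxe, hes.trans Finset.subset_union_left⟩
  · exact ⟨e, hI he, hx, (Finset.le_sup (f := id) he : e ≤ _).trans
      (Finset.subset_union_right)⟩

lemma card_supersets (T U : Finset ℕ) (hU : U ⊆ T) :
    (T.powerset.filter (fun S => U ⊆ S)).card = 2 ^ (T.card - U.card) := by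
  have : T.powerset.filter (fun S => U ⊆ S) = Finset.Icc U T := by
    ext S; simp [Finset.mem_Icc, and_comm]
  rw [this, Finset.card_Icc_finset hU]

lemma many_outside (k h : ℕ) (hk : 2 ≤ k) (hh : 1 ≤ h) (A : Finset (Finset ℕ))
    (hA : ∀ e ∈ A, e.card = k) (T W : Finset ℕ) (hTW : Disjoint T W)
    (hW : ∀ w ∈ W, ∃ e ∈ A, w ∈ e) (hbig : k * (2 ^ (k + 1) * h) ≤ W.card)
    (hbad : (T.powerset.filter (fun S => ¬ Cov A S)).card * 2 ^ (k + 2) ≤ 2 ^ T.card) :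
    2 ^ (T.card + h) ≤ ((unionClosure A).card + 1) * 2 ^ (k + 2) := by
  obtain ⟨E, hEA, hcov, hpriv⟩ := exists_private A W hW
  have hWE : W.card ≤ E.card * k := by
    have : W ⊆ E.biUnion id := by
      intro w hw
      obtain ⟨e, he, hwe⟩ := hcov w hw
      exact Finset.mem_biUnion.2 ⟨e, he, hwe⟩
    refine (Finset.card_le_card this).trans ?_
    exact Finset.card_biUnion_le_card_mul _ _ _ (fun e he => (hA e (hEA he)).le)
  have hr : 2 ^ (k + 1) * h ≤ E.card := by
    have := hbig.trans hWE
    rw [mul_comm k] at this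
    exact Nat.le_of_mul_le_mul_right this (by omega)
  have hrpos : 0 < E.card := lt_of_lt_of_le (by positivity) hr
  set ES : Finset ℕ → Finset (Finset ℕ) := fun S => E.filter (fun e => e ∩ T ⊆ S) with hES
  -- double counting
  have hdc : E.card * 2 ^ T.card ≤ (∑ S ∈ T.powerset, (ES S).card) * 2 ^ k := by
    have : ∑ S ∈ T.powerset, (ES S).card =
        ∑ e ∈ E, (T.powerset.filter (fun S => e ∩ T ⊆ S)).card :=
      Finset.sum_card_bipartiteAbove_eq_sum_card_bipartiteBelow (fun S e => e ∩ T ⊆ S)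
    rw [this, Finset.sum_mul, ← smul_eq_mul E.card]
    apply Finset.card_nsmul_le_sum
    intro e he
    rw [card_supersets _ _ Finset.inter_subset_right, ← pow_add]
    apply Nat.pow_le_pow_right (by norm_num)
    have : (e ∩ T).card ≤ k := (Finset.card_le_card Finset.inter_subset_left).trans
      (hA e (hEA he)).le
    omega
  set H := T.powerset.filter (fun S => h ≤ (ES S).card) with hH
  have hHc : 2 ^ T.card ≤ H.card * 2 ^ (k + 1) := by
    have h1 : (∑ S ∈ T.powerset, (ES S).card) * 2 ^ (k + 1) ≤
        H.card * (E.card * 2 ^ (k + 1)) + 2 ^ T.card * E.card := by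
      rw [Finset.sum_mul, ← Finset.sum_filter_add_sum_filter_not T.powerset (fun S => h ≤ (ES S).card)]
      apply Nat.add_le_add
      · rw [← smul_eq_mul H.card]
        apply Finset.sum_le_card_nsmul
        intro S _
        exact Nat.mul_le_mul_right _ (Finset.card_filter_le _ _)
      · have h2 : (T.powerset.filter (fun S => ¬ h ≤ (ES S).card)).card ≤ 2 ^ T.card := by
          rw [← Finset.card_powerset]; exact Finset.card_filter_le _ _
        refine le_trans ?_ (Nat.mul_le_mul_right _ h2)
        rw [← smul_eq_mul (Finset.card _)]
        apply Finset.sum_le_card_nsmul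
        intro S hS
        rw [Finset.mem_filter] at hS
        have : (ES S).card ≤ h := by omega
        calc (ES S).card * 2 ^ (k + 1) ≤ h * 2 ^ (k + 1) := Nat.mul_le_mul_right _ this
          _ ≤ E.card := by rw [mul_comm]; exact hr
    have h3 : 2 * (E.card * 2 ^ T.card) ≤ H.card * (E.card * 2 ^ (k + 1)) + 2 ^ T.card * E.card := by
      refine le_trans ?_ h1
      rw [pow_succ]; nlinarith
    have h4 : E.card * 2 ^ T.card ≤ E.card * (H.card * 2 ^ (k + 1)) := by nlinarith
    exact Nat.le_of_mul_le_mul_left h4 hrpos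
  set Hg := H.filter (fun S => Cov A S) with hHg
  have hHg' : H.card ≤ Hg.card + (T.powerset.filter (fun S => ¬ Cov A S)).card := by
    rw [← Finset.card_filter_add_card_filter_not (s := H) (fun S => Cov A S)]
    gcongr
    exact Finset.filter_subset _ _
  have hHgc : 2 ^ T.card ≤ Hg.card * 2 ^ (k + 2) := by
    have := Nat.mul_le_mul_right (2 ^ (k + 2)) hHg'
    have e : (2 : ℕ) ^ (k + 2) = 2 * 2 ^ (k + 1) := by rw [pow_succ]; ring
    nlinarith
  -- the injection
  have hinj : (Hg.sigma (fun S => (ES S).powerset)).card ≤ (unionClosure A).card + 1 := by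
    have hci : ((Hg.sigma (fun S => (ES S).powerset)).image
        (fun p => p.1 ∪ p.2.sup id)).card = (Hg.sigma (fun S => (ES S).powerset)).card := by
      apply Finset.card_image_of_injOn
      have fact : ∀ S I, S ∈ Hg → I ⊆ ES S → (S ∪ I.sup id) ∩ T = S := by
        intro S I hS hI
        have hST : S ⊆ T := by
          simp only [hHg, hH, Finset.mem_filter, Finset.mem_powerset] at hS
          exact hS.1.1
        ext x
        rw [Finset.mem_inter, Finset.mem_union, Finset.mem_sup]
        constructor
        · rintro ⟨hx | ⟨e, he, hxe⟩, hxT⟩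
          · exact hx
          · exact (Finset.mem_filter.1 (hI he)).2 (Finset.mem_inter.2 ⟨hxe, hxT⟩)
        · intro hx
          exact ⟨Or.inl hx, hST hx⟩
      have fact2 : ∀ S I J, S ∈ Hg → I ⊆ ES S → J ⊆ ES S → S ∪ I.sup id = S ∪ J.sup id → I ⊆ J := by
        intro S I J hS hI hJ heq e he
        have hST : S ⊆ T := by
          simp only [hHg, hH, Finset.mem_filter, Finset.mem_powerset] at hS
          exact hS.1.1
        have heE := (Finset.mem_filter.1 (hI he)).1
        obtain ⟨w, hwW, hwe, hu⟩ := hpriv e heE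
        have hw : w ∈ S ∪ J.sup id := by
          rw [← heq, Finset.mem_union, Finset.mem_sup]
          exact Or.inr ⟨e, he, hwe⟩
        rw [Finset.mem_union, Finset.mem_sup] at hw
        rcases hw with hw | ⟨f, hf, hwf⟩
        · exact absurd hwW (Finset.disjoint_left.1 hTW (hST hw))
        · rw [← hu f (Finset.mem_filter.1 (hJ hf)).1 hwf]; exact hf
      rintro ⟨S, I⟩ h1 ⟨S', J⟩ h2 heq
      simp only [Finset.mem_coe, Finset.mem_sigma, Finset.mem_powerset] at h1 h2
      simp only at heq
      have : S = S' := by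
        rw [← fact S I h1.1 h1.2, heq, fact S' J h2.1 h2.2]
      subst this
      have : I = J := Finset.Subset.antisymm (fact2 S I J h1.1 h1.2 h2.2 heq)
        (fact2 S J I h1.1 h2.2 h1.2 heq.symm)
      rw [this]
    rw [← hci]
    apply card_le_uc
    · intro e he
      rw [← Finset.card_pos, hA e he]; omega
    · intro X hX
      obtain ⟨⟨S, I⟩, hp, rfl⟩ := Finset.mem_image.1 hX
      simp only [Finset.mem_sigma, Finset.mem_powerset] at hp
      exact Cov.union_family (Finset.mem_filter.1 hp.1).2
        (hp.2.trans ((Finset.filter_subset _ _).trans hEA))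
  have hsum : Hg.card * 2 ^ h ≤ (Hg.sigma (fun S => (ES S).powerset)).card := by
    rw [Finset.card_sigma, ← smul_eq_mul]
    apply Finset.card_nsmul_le_sum
    intro S hS
    rw [Finset.card_powerset]
    apply Nat.pow_le_pow_right (by norm_num)
    exact (Finset.mem_filter.1 (Finset.mem_filter.1 hS).1).2
  calc 2 ^ (T.card + h) = 2 ^ T.card * 2 ^ h := pow_add _ _ _
    _ ≤ Hg.card * 2 ^ (k + 2) * 2 ^ h := by gcongr
    _ = Hg.card * 2 ^ h * 2 ^ (k + 2) := by ring
    _ ≤ _ := by gcongr; exact hsum.trans hinj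

lemma choose_ratio (k u t : ℕ) (hk : 1 ≤ k) (hut : u ≤ t) :
    t * u.choose k ≤ u * t.choose k := by
  obtain ⟨j, rfl⟩ : ∃ j, k = j + 1 := ⟨k - 1, by omega⟩
  rcases u with _ | u
  · simp
  rcases t with _ | t
  · omega
  have h1 := Nat.add_one_mul_choose_eq u j
  have h2 := Nat.add_one_mul_choose_eq t j
  have h3 : u.choose j ≤ t.choose j := Nat.choose_le_choose _ (by omega)
  have : (t + 1) * (u + 1).choose (j + 1) * (j + 1) ≤ (u + 1) * (t + 1).choose (j + 1) * (j + 1) := by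
    calc _ = (t + 1) * ((u + 1) * u.choose j) := by rw [h1]; ring
      _ ≤ (t + 1) * ((u + 1) * t.choose j) := by gcongr
      _ = (u + 1) * ((t + 1) * t.choose j) := by ring
      _ = _ := by rw [h2]; ring
  exact Nat.le_of_mul_le_mul_right this (by omega)

/-- number of subsets of a `t`-set of size `< k` -/
def beta (t k : ℕ) : ℕ := ∑ j ∈ Finset.range k, t.choose j

lemma card_big (T : Finset ℕ) (k : ℕ) :
    (T.powerset.filter (fun S => k ≤ S.card)).card + beta T.card k = 2 ^ T.card := by
  have h1 : (T.powerset.filter (fun S => ¬ k ≤ S.card)).card = beta T.card k := by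
    have : T.powerset.filter (fun S => ¬ k ≤ S.card) =
        (Finset.range k).biUnion (fun j => Finset.powersetCard j T) := by
      ext S
      simp only [Finset.mem_filter, Finset.mem_powerset, Finset.mem_biUnion, Finset.mem_range,
        Finset.mem_powersetCard, not_le]
      constructor
      · rintro ⟨a, b⟩; exact ⟨_, b, a, rfl⟩
      · rintro ⟨j, b, a, rfl⟩; exact ⟨a, b⟩
    rw [this, Finset.card_biUnion]
    · simp [beta]
    · intro a _ b _ hab
      exact Finset.pairwise_disjoint_powersetCard T hab
  rw [← h1, Finset.card_filter_add_card_filter_not, Finset.card_powerset]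

lemma target_upper (k l t : ℕ) (hk : 2 ≤ k) (ht : k - 2 + l ≤ t) :
    (unionClosure (Finset.powersetCard k (Finset.Icc 1 t) ∪
            (Finset.Icc 1 l).image fun i =>
              insert (t + 1) (insert (k - 2 + i) (Finset.Icc 1 (k - 2))))).card
      + beta t k + 2 ^ (t - (k - 2) - l) ≤ 2 ^ t + 2 ^ (t - (k - 2)) := by
  set C := (Finset.powersetCard k (Finset.Icc 1 t) ∪
            (Finset.Icc 1 l).image fun i =>
              insert (t + 1) (insert (k - 2 + i) (Finset.Icc 1 (k - 2)))) with hC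
  have hCm : ∀ e ∈ C, (e ⊆ Finset.Icc 1 t ∧ e.card = k) ∨
      ∃ i, 1 ≤ i ∧ i ≤ l ∧ e = insert (t + 1) (insert (k - 2 + i) (Finset.Icc 1 (k - 2))) := by
    intro e he
    rw [hC, Finset.mem_union, Finset.mem_powersetCard, Finset.mem_image] at he
    rcases he with he | ⟨i, hi, rfl⟩
    · exact Or.inl he
    · rw [Finset.mem_Icc] at hi
      exact Or.inr ⟨i, hi.1, hi.2, rfl⟩
  have hne : ∀ e ∈ C, e.Nonempty := by
    intro e he
    rcases hCm e he with h | ⟨i, -, -, rfl⟩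
    · rw [← Finset.card_pos]; omega
    · exact Finset.insert_nonempty _ _
  set P1 := (Finset.Icc 1 t).powerset.filter (fun S => k ≤ S.card)
  set Q := (Finset.Icc 1 t).powerset.filter (fun S => Finset.Icc 1 (k - 2) ⊆ S)
  set Q0 := (Finset.Icc 1 t \ Finset.Icc (k - 2 + 1) (k - 2 + l)).powerset.filter
    (fun S => Finset.Icc 1 (k - 2) ⊆ S)
  have hQ : Q.card = 2 ^ (t - (k - 2)) := by
    have := card_supersets (Finset.Icc 1 t) (Finset.Icc 1 (k - 2))
      (Finset.Icc_subset_Icc le_rfl (by omega))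
    simpa using this
  have hQ0 : Q0.card = 2 ^ (t - (k - 2) - l) := by
    have := card_supersets (Finset.Icc 1 t \ Finset.Icc (k - 2 + 1) (k - 2 + l))
      (Finset.Icc 1 (k - 2)) (by
        intro x hx
        simp only [Finset.mem_sdiff, Finset.mem_Icc] at hx ⊢
        omega)
    rw [this, Finset.card_sdiff_of_subset (Finset.Icc_subset_Icc (by omega) ht)]
    simp only [Nat.card_Icc]
    congr 1
    omega
  have hQ0Q : Q0 ⊆ Q := by
    intro S hS
    rw [Finset.mem_filter, Finset.mem_powerset] at hS ⊢
    exact ⟨hS.1.trans Finset.sdiff_subset, hS.2⟩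
  have hsub : unionClosure C ⊆ P1 ∪ (Q \ Q0).image (fun S => insert (t + 1) S) := by
    intro X hX
    rw [mem_uc hne] at hX
    obtain ⟨⟨x, hx⟩, hcov⟩ := hX
    have hXsub : X ⊆ insert (t + 1) (Finset.Icc 1 t) := by
      intro y hy
      obtain ⟨e, he, hye, -⟩ := hcov y hy
      rcases hCm e he with h | ⟨i, h1, h2, rfl⟩
      · exact Finset.mem_insert_of_mem (h.1 hye)
      · simp only [Finset.mem_insert, Finset.mem_Icc] at hye ⊢
        omega
    rw [Finset.mem_union]
    by_cases hX1 : t + 1 ∈ X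
    · right
      obtain ⟨e, he, hye, heX⟩ := hcov _ hX1
      rcases hCm e he with h | ⟨i, h1, h2, rfl⟩
      · have := h.1 hye
        rw [Finset.mem_Icc] at this
        omega
      · rw [Finset.mem_image]
        refine ⟨X.erase (t + 1), ?_, Finset.insert_erase hX1⟩
        rw [Finset.mem_sdiff, Finset.mem_filter, Finset.mem_filter, Finset.mem_powerset,
          Finset.mem_powerset]
        refine ⟨⟨?_, ?_⟩, ?_⟩
        · rw [← Finset.subset_insert_iff]; exact hXsub
        · intro y hy
          rw [Finset.mem_erase]
          refine ⟨?_, heX (by simp only [Finset.mem_insert]; tauto)⟩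
          rw [Finset.mem_Icc] at hy; omega
        · rintro ⟨h, -⟩
          have : k - 2 + i ∈ X.erase (t + 1) := by
            rw [Finset.mem_erase]
            exact ⟨by omega, heX (by simp)⟩
          have := h this
          simp only [Finset.mem_sdiff, Finset.mem_Icc] at this
          omega
    · left
      rw [Finset.mem_filter, Finset.mem_powerset]
      refine ⟨fun y hy => ?_, ?_⟩
      · rcases Finset.mem_insert.1 (hXsub hy) with rfl | h
        · exact absurd hy hX1
        · exact h
      · obtain ⟨e, he, hye, heX⟩ := hcov _ hx
        rcases hCm e he with h | ⟨i, h1, h2, rfl⟩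
        · rw [← h.2]; exact Finset.card_le_card heX
        · exact absurd (heX (Finset.mem_insert_self _ _)) hX1
  have h1 := (Finset.card_le_card hsub).trans ((Finset.card_union_le _ _).trans
    (Nat.add_le_add_left Finset.card_image_le _))
  rw [Finset.card_sdiff_of_subset hQ0Q] at h1
  have h2 := card_big (Finset.Icc 1 t) k
  rw [Nat.card_Icc, Nat.add_sub_cancel] at h2
  have h3 := Finset.card_le_card hQ0Q
  change P1.card + _ = _ at h2
  omega

lemma asym (j K c : ℕ) (hj : 1 ≤ j) : ∃ M0 : ℕ, ∀ M, M0 ≤ M →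
    K * (M + 1) ^ 2 * (2 ^ j - 1) ^ M * 2 ^ c ≤ (2 ^ j) ^ M := by
  set q : ℝ := ((2 ^ j - 1 : ℕ) : ℝ) / 2 ^ j with hq
  have hq0 : 0 ≤ q := by positivity
  have h2j : (0 : ℝ) < 2 ^ j := by positivity
  have hq1 : q < 1 := by
    rw [hq, div_lt_one h2j]
    have : (2 ^ j - 1 : ℕ) < 2 ^ j := Nat.sub_lt (by positivity) (by norm_num)
    exact_mod_cast this
  have ht := tendsto_pow_const_mul_const_pow_of_abs_lt_one 2 (by rwa [abs_of_nonneg hq0])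
  have hpos : (0 : ℝ) < 1 / (4 * (K + 1) * 2 ^ c) := by positivity
  obtain ⟨M0, hM0⟩ := (ht.eventually (gt_mem_nhds hpos)).exists_forall_of_atTop
  refine ⟨M0 + 1, fun M hM => ?_⟩
  have h := hM0 M (by omega)
  rw [lt_div_iff₀ (by positivity), hq, div_pow] at h
  have hM1 : (1 : ℝ) ≤ M := by exact_mod_cast (by omega : 1 ≤ M)
  have hd : (0 : ℝ) < (2 ^ j) ^ M := by positivity
  set a : ℝ := ((2 ^ j - 1 : ℕ) : ℝ) ^ M with ha
  have ha0 : 0 ≤ a := by positivity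
  have h' : (M : ℝ) ^ 2 * a * (4 * (K + 1) * 2 ^ c) < (2 ^ j) ^ M := by
    have e : (M : ℝ) ^ 2 * (a / (2 ^ j) ^ M) * (4 * (K + 1) * 2 ^ c) =
      ((M : ℝ) ^ 2 * a * (4 * (K + 1) * 2 ^ c)) / (2 ^ j) ^ M := by ring
    rw [e, div_lt_one hd] at h
    exact h
  have h4 : ((M : ℝ) + 1) ^ 2 ≤ 4 * (M : ℝ) ^ 2 := by nlinarith
  have goal : (K : ℝ) * (M + 1) ^ 2 * a * 2 ^ c ≤ (2 ^ j) ^ M := by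
    refine le_trans ?_ h'.le
    calc (K : ℝ) * (M + 1) ^ 2 * a * 2 ^ c ≤ (K + 1) * (4 * (M : ℝ) ^ 2) * a * 2 ^ c := by
          gcongr; linarith
      _ = _ := by ring
  rw [ha] at goal
  exact_mod_cast goal

lemma union_decomp {e S T : Finset ℕ} (hS : S ⊆ T) :
    e ∪ S = ((e ∪ S) ∩ T) ∪ ({e} : Finset (Finset ℕ)).sup id := by
  ext x
  have := @hS x
  simp only [Finset.mem_union, Finset.mem_inter, Finset.sup_singleton, id]
  tauto

lemma fiber_bound (A : Finset (Finset ℕ)) (hA : ∀ e ∈ A, e.Nonempty) (T : Finset ℕ)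
    (E : Finset (Finset ℕ)) (hE : E ⊆ A) (hET : ∀ e ∈ E, ¬ e ⊆ T) :
    2 ^ T.card + (Pup T E).card ≤ (unionClosure A).card + 1 +
      (E.card + 1) * (T.powerset.filter (fun S => ¬ Cov A S)).card := by
  set B := T.powerset.filter (fun S => ¬ Cov A S)
  set F1 := T.powerset.filter (fun S => Cov A S)
  set F2 := (Pup T E).filter (fun X => Cov A (X ∩ T))
  have h1 : F1.card + B.card = 2 ^ T.card := by
    rw [← Finset.card_powerset]; exact Finset.card_filter_add_card_filter_not _
  have h2 : (Pup T E).card ≤ F2.card + E.card * B.card := by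
    rw [← Finset.card_filter_add_card_filter_not (s := Pup T E) (fun X => Cov A (X ∩ T))]
    gcongr
    rw [← Finset.card_product]
    refine le_trans (Finset.card_le_card ?_)
      (Finset.card_image_le (f := fun p : Finset ℕ × Finset ℕ => (p.1 \ T) ∪ p.2))
    intro X hX
    rw [Finset.mem_filter] at hX
    obtain ⟨e, he, S, hS, rfl⟩ := mem_Pup.1 hX.1
    rw [Finset.mem_image]
    refine ⟨(e, (e ∪ S) ∩ T), ?_, ?_⟩
    · rw [Finset.mem_product, Finset.mem_filter, Finset.mem_powerset]
      exact ⟨he, Finset.inter_subset_right, hX.2⟩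
    · ext x
      have := @hS x
      simp only [Finset.mem_union, Finset.mem_sdiff, Finset.mem_inter]
      tauto
  have h3 : (F1 ∪ F2).card ≤ (unionClosure A).card + 1 := by
    apply card_le_uc hA
    intro X hX
    rcases Finset.mem_union.1 hX with h | h
    · exact (Finset.mem_filter.1 h).2
    · rw [Finset.mem_filter] at h
      obtain ⟨e, he, S, hS, rfl⟩ := mem_Pup.1 h.1
      have := Cov.union_family h.2 (I := {e}) (by simpa using hE he)
      rwa [← union_decomp hS] at this
  rw [Finset.card_union_of_disjoint] at h3
  · nlinarith
  · rw [Finset.disjoint_left]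
    intro X hX hX2
    rw [Finset.mem_filter, Finset.mem_powerset] at hX
    rw [Finset.mem_filter] at hX2
    obtain ⟨e, he, S, hS, rfl⟩ := mem_Pup.1 hX2.1
    exact hET e he (Finset.subset_union_left.trans hX.1)

set_option maxHeartbeats 1000000 in
lemma case_eq (k l t : ℕ) (hk : 2 ≤ k) (ht : k - 2 + l ≤ t) (A : Finset (Finset ℕ))
    (hA : ∀ e ∈ A, e.card = k) (hc : A.card = t.choose k + l) (T : Finset ℕ) (hT : T.card = t)
    (hbad : (T.powerset.filter (fun S => ¬ Cov A S)).card * 2 ^ (k + 2 * l + 4) ≤ 2 ^ T.card)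
    (Tg : ℕ) (hTg : Tg + beta t k + 2 ^ (t - (k - 2) - l) ≤ 2 ^ t + 2 ^ (t - (k - 2)))
    (hbeta : 1 ≤ beta t k) :
    Tg ≤ (unionClosure A).card := by
  have hAne : ∀ e ∈ A, e.Nonempty := fun e he => by
    rw [← Finset.card_pos, hA e he]; omega
  set b := (T.powerset.filter (fun S => ¬ Cov A S)).card with hb
  set Z := 2 ^ (t - (k - 2) - l) with hZ
  have hZpos : 0 < Z := by positivity
  set R := 2 ^ (k - 2) with hR
  set L := 2 ^ l with hL
  have hRpos : 0 < R := by positivity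
  have hLpos : 0 < L := by positivity
  have e1 : 2 ^ (t - (k - 2)) = Z * L := by
    rw [hZ, hL, ← pow_add]; congr 1; omega
  have e2 : 2 ^ t = Z * L * R := by
    rw [← e1, hR, ← pow_add]; congr 1; omega
  have e3 : 2 ^ (k + 2 * l + 4) = 64 * L * L * R := by
    rw [hL, hR, show (64 : ℕ) = 2 ^ 6 from rfl, ← pow_add, ← pow_add, ← pow_add]; congr 1; omega
  rw [hT, e3, e2] at hbad
  have hb1 : b * (64 * L) ≤ Z := by
    have : b * (64 * L) * (L * R) ≤ Z * (L * R) := by nlinarith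
    exact Nat.le_of_mul_le_mul_right this (by positivity)
  have hlL : l + 2 ≤ 2 * L := by
    have : l < 2 ^ l := Nat.lt_two_pow_self
    omega
  have hb2 : (l + 2) * b * 32 ≤ Z := by
    have := Nat.mul_le_mul_right (b * 32) hlL
    nlinarith
  set E := A.filter (fun e => ¬ e ⊆ T) with hE
  have hin : (A.filter (fun e => e ⊆ T)) ⊆ Finset.powersetCard k T := by
    intro e he
    rw [Finset.mem_filter] at he
    exact Finset.mem_powersetCard.2 ⟨he.2, hA e he.1⟩
  have hsum : (A.filter (fun e => e ⊆ T)).card + E.card = t.choose k + l := by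
    rw [← hc]; exact Finset.card_filter_add_card_filter_not _
  have hinc := Finset.card_le_card hin
  rw [Finset.card_powersetCard, hT] at hinc
  have hEl : l ≤ E.card := by omega
  have hETk : ∀ e ∈ E, (e ∩ T).card ≤ k - 1 := by
    intro e he
    rw [Finset.mem_filter] at he
    have : (e ∩ T).card < e.card := by
      apply Finset.card_lt_card
      refine ⟨Finset.inter_subset_left, fun h => he.2 (h.trans Finset.inter_subset_right)⟩
    rw [hA e he.1] at this
    omega
  rw [e1, e2] at hTg
  by_cases hq : l + 1 ≤ E.card
  · obtain ⟨E', hE', hE'c⟩ := Finset.exists_subset_card_eq hq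
    have hf := fiber_bound A hAne T E' (hE'.trans (Finset.filter_subset _ _))
      (fun e he => (Finset.mem_filter.1 (hE' he)).2)
    have hp := card_Pup T (k - 2) E' (fun e he => by
      have := hETk e (hE' he); omega)
    rw [hE'c, hT, pow_succ, ← hL, ← hR, e2] at hp
    rw [hE'c, hT, ← hb, e2] at hf
    set p := (Pup T E').card
    have hp2 : Z * L * 2 ≤ 2 * p + Z := by
      have : (Z * L * 2) * (L * R) ≤ (2 * p + Z) * (L * R) := by nlinarith
      exact Nat.le_of_mul_le_mul_right this (by positivity)
    have : (l + 1 + 1) * b = (l + 2) * b := rfl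
    rw [this] at hf
    omega
  · have hEl' : E.card = l := by omega
    have hall : A.filter (fun e => e ⊆ T) = Finset.powersetCard k T := by
      apply Finset.eq_of_subset_of_card_le hin
      rw [Finset.card_powersetCard, hT]; omega
    by_cases hsm : ∃ e ∈ E, (e ∩ T).card ≤ k - 2
    · obtain ⟨e, he, hek⟩ := hsm
      have heA := Finset.mem_filter.1 he
      have hf := fiber_bound A hAne T {e} (by simpa using heA.1) (by simpa using heA.2)
      have hp : Z * L ≤ (Pup T {e}).card := by
        have h1 : (Pup (T \ e) {e}).card ≤ (Pup T {e}).card := by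
          apply Finset.card_le_card
          intro X hX
          obtain ⟨f, hf, S, hS, rfl⟩ := mem_Pup.1 hX
          exact mem_Pup.2 ⟨f, hf, S, hS.trans Finset.sdiff_subset, rfl⟩
        rw [card_Pup_disj (by
          intro f hf
          rw [Finset.mem_singleton] at hf
          subst hf
          ext x; simp only [Finset.mem_inter, Finset.mem_sdiff]
          simp; tauto)] at h1
        refine le_trans ?_ h1
        rw [← e1, Finset.card_singleton, one_mul]
        apply Nat.pow_le_pow_right (by norm_num)
        have h3 := Finset.card_sdiff_add_card_inter T e
        rw [Finset.inter_comm] at h3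
        omega
      rw [Finset.card_singleton, hT, ← hb, e2] at hf
      have : 2 * b ≤ (l + 2) * b := Nat.mul_le_mul_right _ (by omega)
      omega
    · push Not at hsm
      have hbigcov : ∀ S, S ⊆ T → k ≤ S.card → Cov A S := by
        intro S hS hSk x hx
        obtain ⟨e, hxe, heS, hec⟩ := Finset.exists_subsuperset_card_eq
          (Finset.singleton_subset_iff.2 hx) (by simp; omega) hSk
        refine ⟨e, ?_, Finset.singleton_subset_iff.1 hxe, heS⟩
        have : e ∈ A.filter (fun e => e ⊆ T) := by
          rw [hall, Finset.mem_powersetCard]; exact ⟨heS.trans hS, hec⟩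
        exact (Finset.mem_filter.1 this).1
      have hp := card_Pup T (k - 2) E (fun e he => by
        have := hETk e he; omega)
      rw [hEl', hT, ← hL, ← hR, e2] at hp
      have hbg := card_big T k
      rw [hT, e2] at hbg
      have hF := card_le_uc' hAne
        (T.powerset.filter (fun S => k ≤ S.card) ∪ Pup T E) (by
          intro X hX
          rcases Finset.mem_union.1 hX with h | h
          · rw [Finset.mem_filter, Finset.mem_powerset] at h
            exact ⟨Finset.card_pos.1 (by omega), hbigcov X h.1 h.2⟩
          · obtain ⟨e, he, S, hS, rfl⟩ := mem_Pup.1 h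
            have heA := Finset.mem_filter.1 he
            refine ⟨(hAne e heA.1).mono Finset.subset_union_left, ?_⟩
            by_cases hcard : k ≤ ((e ∪ S) ∩ T).card
            · have := Cov.union_family (hbigcov _ Finset.inter_subset_right hcard)
                (I := {e}) (by simpa using heA.1)
              rwa [← union_decomp hS] at this
            · have h1 : e ∩ T ⊆ (e ∪ S) ∩ T :=
                Finset.inter_subset_inter_right Finset.subset_union_left
              have h2 := Finset.eq_of_subset_of_card_le h1 (by
                have := hsm e he; omega)
              have h3 : e ∪ S = e := by
                apply Finset.union_eq_left.2
                intro x hx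
                have : x ∈ e ∩ T := by
                  rw [h2]; exact Finset.mem_inter.2 ⟨Finset.mem_union_right _ hx, hS hx⟩
                exact (Finset.mem_inter.1 this).1
              rw [h3]
              intro x hx
              exact ⟨e, heA.1, hx, subset_refl _⟩)
      rw [Finset.card_union_of_disjoint] at hF
      · set p := (Pup T E).card
        have hp2 : Z * L ≤ p + Z := by
          have : (Z * L) * (L * R) ≤ (p + Z) * (L * R) := by nlinarith
          exact Nat.le_of_mul_le_mul_right this (by positivity)
        omega
      · rw [Finset.disjoint_left]
        intro X hX hX2
        rw [Finset.mem_filter, Finset.mem_powerset] at hX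
        obtain ⟨e, he, S, hS, rfl⟩ := mem_Pup.1 hX2
        exact (Finset.mem_filter.1 he).2 (Finset.subset_union_left.trans hX.1)

lemma case_gt (k l t : ℕ) (hk : 2 ≤ k) (ht : k - 2 + l ≤ t) (A : Finset (Finset ℕ))
    (hA : ∀ e ∈ A, e.card = k) (T : Finset ℕ) (hT : t < T.card)
    (hbad : (T.powerset.filter (fun S => ¬ Cov A S)).card * 2 ^ (k + 2 * l + 4) ≤ 2 ^ T.card)
    (Tg : ℕ) (hTg : Tg + beta t k + 2 ^ (t - (k - 2) - l) ≤ 2 ^ t + 2 ^ (t - (k - 2)))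
    (hbeta : 1 ≤ beta t k) :
    Tg ≤ (unionClosure A).card := by
  have hAne : ∀ e ∈ A, e.Nonempty := fun e he => by
    rw [← Finset.card_pos, hA e he]; omega
  have hF := card_le_uc hAne (T.powerset.filter (fun S => Cov A S))
    (fun X hX => (Finset.mem_filter.1 hX).2)
  have hs : (T.powerset.filter (fun S => Cov A S)).card +
      (T.powerset.filter (fun S => ¬ Cov A S)).card = 2 ^ T.card := by
    rw [← Finset.card_powerset]; exact Finset.card_filter_add_card_filter_not _
  set b := (T.powerset.filter (fun S => ¬ Cov A S)).card
  set f := (T.powerset.filter (fun S => Cov A S)).card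
  set Z := 2 ^ (t - (k - 2) - l) with hZ
  set c := k + 2 * l + 4 with hc
  have h1 : 2 ^ (t + 1) ≤ 2 ^ T.card := Nat.pow_le_pow_right (by norm_num) hT
  have h2 : 2 ^ (t + 1) ≤ Z * 2 ^ c := by
    rw [hZ, ← pow_add]; exact Nat.pow_le_pow_right (by norm_num) (by omega)
  have h3 : 2 ^ (t + 1) ≤ f + Z := by
    have hcpos : 1 ≤ 2 ^ c := Nat.one_le_two_pow
    have : 2 ^ (t + 1) * 2 ^ c ≤ (f + Z) * 2 ^ c := by
      obtain ⟨d, hd⟩ := Nat.exists_eq_add_of_le hcpos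
      rw [hd] at hbad h2 ⊢
      have := Nat.mul_le_mul_right d h1
      nlinarith
    exact Nat.le_of_mul_le_mul_right this (by positivity)
  have h4 : 2 ^ (t - (k - 2)) ≤ 2 ^ t := Nat.pow_le_pow_right (by norm_num) (by omega)
  rw [pow_succ] at h3
  omega

lemma finish_big (k l t : ℕ) (U Tg : ℕ) (hU : 2 ^ (t + k + 4) ≤ (U + 1) * 2 ^ (k + 2))
    (hTg : Tg + beta t k + 2 ^ (t - (k - 2) - l) ≤ 2 ^ t + 2 ^ (t - (k - 2)))
    (hbeta : 1 ≤ beta t k) : Tg ≤ U := by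
  have h4 : 2 ^ (t - (k - 2)) ≤ 2 ^ t := Nat.pow_le_pow_right (by norm_num) (by omega)
  have : 2 ^ (t + 2) ≤ U + 1 := by
    have h : 2 ^ (t + 2) * 2 ^ (k + 2) ≤ (U + 1) * 2 ^ (k + 2) := by
      rw [← pow_add]; convert hU using 2; omega
    exact Nat.le_of_mul_le_mul_right h (by positivity)
  rw [pow_succ, pow_succ] at this
  have h5 : 0 < 2 ^ t := by positivity
  have h6 : 0 < 2 ^ (t - (k - 2) - l) := by positivity
  omega

lemma outside_bound (k t K M W s out : ℕ) (hk : 2 ≤ k) (ht : 2 * k ≤ t) (hs : 1 ≤ s)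
    (hM : M * M ≤ t)
    (hMbig : (2 ^ k * k.factorial * ((k - 1) * K ^ (k - 2))) * K ≤ M) (hK : 1 ≤ K)
    (h1 : s * t.choose k ≤ t * out)
    (h2 : out ≤ W * (M * ((k - 1) * (K * t) ^ (k - 2)))) :
    K * s ≤ W := by
  obtain ⟨j, rfl⟩ : ∃ j, k = j + 2 := ⟨k - 2, by omega⟩
  simp only [Nat.add_sub_cancel] at *
  have hj1 : j + 2 - 1 = j + 1 := rfl
  rw [hj1] at *
  have hd := Nat.pow_sub_le_descFactorial t (j + 2)
  rw [Nat.descFactorial_eq_factorial_mul_choose] at hd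
  have hp : t ^ (j + 2) ≤ 2 ^ (j + 2) * ((j + 2).factorial * t.choose (j + 2)) := by
    calc t ^ (j + 2) ≤ (2 * (t + 1 - (j + 2))) ^ (j + 2) := by
          apply Nat.pow_le_pow_left; omega
      _ = 2 ^ (j + 2) * (t + 1 - (j + 2)) ^ (j + 2) := mul_pow _ _ _
      _ ≤ _ := by gcongr
  set K2 := 2 ^ (j + 2) * (j + 2).factorial with hK2
  set K1 := K2 * ((j + 1) * K ^ j) with hK1
  have hK1pos : 0 < K1 := by positivity
  have hMpos : 0 < M := lt_of_lt_of_le (by positivity) hMbig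
  have htpos : 0 < t := by omega
  have h3 : (s * M) * (M * t ^ (j + 1)) ≤ (K1 * W) * (M * t ^ (j + 1)) := by
    calc (s * M) * (M * t ^ (j + 1)) = s * (M * M) * t ^ (j + 1) := by ring
      _ ≤ s * t * t ^ (j + 1) := by gcongr
      _ = s * t ^ (j + 2) := by ring
      _ ≤ s * (2 ^ (j + 2) * ((j + 2).factorial * t.choose (j + 2))) := by gcongr
      _ = K2 * (s * t.choose (j + 2)) := by rw [hK2]; ring
      _ ≤ K2 * (t * (W * (M * ((j + 1) * (K * t) ^ j)))) := 
          Nat.mul_le_mul_left _ (h1.trans (Nat.mul_le_mul_left _ h2))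
      _ = _ := by rw [hK1, mul_pow]; ring
  have h4 := Nat.le_of_mul_le_mul_right h3 (by positivity)
  have h5 : K1 * (K * s) ≤ K1 * W := by
    refine le_trans ?_ h4
    calc K1 * (K * s) = s * (K1 * K) := by ring
      _ ≤ s * M := Nat.mul_le_mul_left _ hMbig
  exact Nat.le_of_mul_le_mul_left h5 hK1pos

lemma main_bound (k l : ℕ) (hk : 2 ≤ k) : ∃ t0 : ℕ, ∀ t : ℕ, t0 < t → k - 2 + l ≤ t ∧
    ∀ A : Finset (Finset ℕ), (∀ S ∈ A, S.card = k) → A.card = t.choose k + l →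
    ∀ Tg : ℕ, Tg + beta t k + 2 ^ (t - (k - 2) - l) ≤ 2 ^ t + 2 ^ (t - (k - 2)) →
      Tg ≤ (unionClosure A).card := by
  set K0 := k * 2 ^ (k + 1) with hK0
  set K := K0 * (k + 5) with hK
  have hKpos : 1 ≤ K := Nat.one_le_iff_ne_zero.2 (by positivity)
  obtain ⟨M0, hM0⟩ := asym (k - 1) K (k + 2 * l + 4) (by omega)
  set M1 := max M0 ((2 ^ k * k.factorial * ((k - 1) * K ^ (k - 2))) * K) with hM1
  refine ⟨M1 * M1 + 2 * k + l + 1, fun t ht => ⟨by omega, ?_⟩⟩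
  intro A hA hc Tg hTg
  have hbeta : 1 ≤ beta t k := by
    unfold beta
    have := Finset.single_le_sum (f := fun j => t.choose j) (fun _ _ => Nat.zero_le _)
      (Finset.mem_range.2 (by omega : 0 < k))
    simpa using this
  set M := Nat.sqrt t with hM
  have hMM : M * M ≤ t := Nat.sqrt_le t
  have hMM2 : t < (M + 1) ^ 2 := by rw [pow_two]; exact Nat.lt_succ_sqrt t
  have hM1M : M1 ≤ M := Nat.le_sqrt.2 (by omega)
  set G := A.sup id with hG
  have hGsub : ∀ e ∈ A, e ⊆ G := fun e he => Finset.le_sup (f := id) he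
  have hGcov : ∀ w ∈ G, ∃ e ∈ A, w ∈ e := fun w hw => by
    rw [hG, Finset.mem_sup] at hw; exact hw
  by_cases hbig : k * (2 ^ (k + 1) * (t + k + 4)) ≤ G.card
  · have := many_outside k (t + k + 4) hk (by omega) A hA ∅ G (by simp) hGcov hbig (by
      rw [Finset.filter_false_of_mem]
      · simp
      · intro S hS
        rw [Finset.powerset_empty, Finset.mem_singleton] at hS
        subst hS
        rw [not_not]
        intro x hx
        simp at hx)
    rw [Finset.card_empty, zero_add] at this
    exact finish_big k l t _ _ this hTg hbeta
  push Not at hbig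
  have hGK : G.card ≤ K * t := by
    refine hbig.le.trans ?_
    have : t + k + 4 ≤ (k + 5) * t := by nlinarith
    calc k * (2 ^ (k + 1) * (t + k + 4)) = K0 * (t + k + 4) := by rw [hK0]; ring
      _ ≤ K0 * ((k + 5) * t) := by gcongr
      _ = K * t := by rw [hK]; ring
  obtain ⟨T, hTG, hdeg, hout⟩ := peel A G hGsub (M * ((k - 1) * (K * t) ^ (k - 2)))
  have hTK : T.card ≤ K * t := (Finset.card_le_card hTG).trans hGK
  have hbb := bad_bound k (K * t) M hk (Nat.mul_pos hKpos (by omega)) A hA T hTK hdeg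
  have hbad : (T.powerset.filter (fun S => ¬ Cov A S)).card * 2 ^ (k + 2 * l + 4) ≤
      2 ^ T.card := by
    have ha := hM0 M ((le_max_left _ _).trans hM1M)
    set b := (T.powerset.filter (fun S => ¬ Cov A S)).card
    have hTM : T.card ≤ K * (M + 1) ^ 2 := hTK.trans (Nat.mul_le_mul_left _ hMM2.le)
    have : (b * 2 ^ (k + 2 * l + 4)) * (2 ^ (k - 1)) ^ M ≤ 2 ^ T.card * (2 ^ (k - 1)) ^ M := by
      calc (b * 2 ^ (k + 2 * l + 4)) * (2 ^ (k - 1)) ^ M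
          = b * (2 ^ (k - 1)) ^ M * 2 ^ (k + 2 * l + 4) := by ring
        _ ≤ T.card * ((2 ^ (k - 1) - 1) ^ M * 2 ^ T.card) * 2 ^ (k + 2 * l + 4) := by gcongr
        _ ≤ K * (M + 1) ^ 2 * ((2 ^ (k - 1) - 1) ^ M * 2 ^ T.card) * 2 ^ (k + 2 * l + 4) := by
            gcongr
        _ = 2 ^ T.card * (K * (M + 1) ^ 2 * (2 ^ (k - 1) - 1) ^ M * 2 ^ (k + 2 * l + 4)) := by ring
        _ ≤ _ := by gcongr
    exact Nat.le_of_mul_le_mul_right this (by positivity)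
  rcases lt_trichotomy T.card t with hlt | heq | hgt
  · set s := t - T.card with hs
    set out := (A.filter (fun e => ¬ e ⊆ T)).card with hout'
    have hin : (A.filter (fun e => e ⊆ T)).card ≤ T.card.choose k := by
      rw [← Finset.card_powersetCard]
      apply Finset.card_le_card
      intro e he
      rw [Finset.mem_filter] at he
      exact Finset.mem_powersetCard.2 ⟨he.2, hA e he.1⟩
    have hsum : (A.filter (fun e => e ⊆ T)).card + out = t.choose k + l := by
      rw [← hc]; exact Finset.card_filter_add_card_filter_not _
    have hr := choose_ratio k T.card t (by omega) hlt.le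
    have h1 : s * t.choose k ≤ t * out := by
      have e1 : t.choose k ≤ T.card.choose k + out := by omega
      have e2 := Nat.mul_le_mul_left t e1
      have e3 : t = s + T.card := by omega
      have e4 : t * t.choose k = s * t.choose k + T.card * t.choose k := by
        rw [← add_mul, ← e3]
      rw [mul_add] at e2
      omega
    have hW := outside_bound k t K M (G \ T).card s out hk (by omega) (by omega) hMM
      ((le_max_right _ _).trans hM1M) hKpos h1 hout
    have hW2 : k * (2 ^ (k + 1) * (s + k + 4)) ≤ (G \ T).card := by
      refine le_trans ?_ hW
      have hs1 : 1 ≤ s := by omega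
      have : s + k + 4 ≤ (k + 5) * s := by nlinarith
      calc k * (2 ^ (k + 1) * (s + k + 4)) = K0 * (s + k + 4) := by rw [hK0]; ring
        _ ≤ K0 * ((k + 5) * s) := by gcongr
        _ = K * s := by rw [hK]; ring
    have := many_outside k (s + k + 4) hk (by omega) A hA T (G \ T) Finset.disjoint_sdiff
      (fun w hw => hGcov w (Finset.mem_sdiff.1 hw).1) hW2
      (le_trans (Nat.mul_le_mul_left _ (Nat.pow_le_pow_right (by norm_num) (by omega))) hbad)
    rw [show T.card + (s + k + 4) = t + k + 4 by omega] at this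
    exact finish_big k l t _ _ this hTg hbeta
  · exact case_eq k l t hk (by omega) A hA hc T heq hbad Tg hTg hbeta
  · exact case_gt k l t hk (by omega) A hA T hgt hbad Tg hTg hbeta

end helpers

theorem stmt12 (k l : ℕ) (hk : 2 ≤ k) (hl : 0 < l) :
    ∃ t0 : ℕ, ∀ t : ℕ, t0 < t →
      ∀ A : Finset (Finset ℕ), (∀ S ∈ A, S.card = k) → A.card = t.choose k + l →
        (unionClosure (Finset.powersetCard k (Finset.Icc 1 t) ∪
            (Finset.Icc 1 l).image fun i =>
              insert (t + 1) (insert (k - 2 + i) (Finset.Icc 1 (k - 2))))).card ≤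
          (unionClosure A).card := by
  obtain ⟨t0, h0⟩ := main_bound k l hk
  refine ⟨t0, fun t ht A hA hc => ?_⟩
  obtain ⟨h1, h2⟩ := h0 t ht
  refine h2 A hA hc _ ?_
  convert target_upper k l t hk h1 using 3
end

section
/- Let p and k be integers with 2 ≤ k and k − 1 ≤ p. Let 𝒯 ⊆ [p]^(k−1) and let ℐ ⊆ [p]^(k−1) be the initial segment of the lex order on [p]^(k−1) with |ℐ| = |𝒯|. Then for every integer r with 1 ≤ r ≤ p − k + 1 we have |∂_+^r 𝒯| ≥ |∂_+^r ℐ|, where ∂_+ is the upper shadow in [p] and ∂_+^r denotes its r-fold iterate. -/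
/-- The upper shadow within the ground set `[p] = {1, …, p}`. -/
def upShadowIn (p : ℕ) (F : Finset (Finset ℕ)) : Finset (Finset ℕ) :=
  F.biUnion fun A => (Finset.Icc 1 p \ A).image fun i => insert i A

/-- `A` is less than or equal to `B` in the lex order: `A = B` or `min (A \ B) < min (B \ A)`. -/
def lexLE (A B : Finset ℕ) : Prop :=
  A = B ∨ ∃ m, m ∈ A ∧ m ∉ B ∧ ∀ x < m, (x ∈ A ↔ x ∈ B)

/-- Complement and reverse. -/
def phiC (p : ℕ) (A : Finset ℕ) : Finset (Fin p) :=
  Finset.univ.filter fun j => p - (j : ℕ) ∉ A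

theorem mem_phiC (p : ℕ) (A : Finset ℕ) (j : Fin p) : j ∈ phiC p A ↔ p - (j : ℕ) ∉ A := by
  simp [phiC]

theorem phiC_lift (p i : ℕ) (hi : i ∈ Finset.Icc 1 p) : ∃ j : Fin p, p - (j : ℕ) = i := by
  rw [Finset.mem_Icc] at hi
  exact ⟨⟨p - i, by omega⟩, by simp only; omega⟩

theorem phiC_sub_inj (p : ℕ) (i j : Fin p) (h : p - (i : ℕ) = p - (j : ℕ)) : i = j := by
  apply Fin.ext
  have := i.2
  have := j.2
  omega

theorem phiC_inj (p : ℕ) (A B : Finset ℕ) (hA : A ⊆ Finset.Icc 1 p) (hB : B ⊆ Finset.Icc 1 p)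
    (h : phiC p A = phiC p B) : A = B := by
  ext x
  have key : ∀ j : Fin p, (p - (j : ℕ) ∈ A ↔ p - (j : ℕ) ∈ B) := by
    intro j
    have := mem_phiC p A j
    rw [h, mem_phiC] at this
    tauto
  by_cases hx : x ∈ Finset.Icc 1 p
  · obtain ⟨j, rfl⟩ := phiC_lift p x hx
    exact key j
  · exact ⟨fun h => absurd (hA h) hx, fun h => absurd (hB h) hx⟩

theorem phiC_card (p : ℕ) (A : Finset ℕ) (hA : A ⊆ Finset.Icc 1 p) :
    (phiC p A).card + A.card = p := by
  have h1 : (phiC p A).image (fun j : Fin p => p - (j : ℕ)) = Finset.Icc 1 p \ A := by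
    ext x
    simp only [Finset.mem_image, mem_phiC, Finset.mem_sdiff]
    constructor
    · rintro ⟨j, hj, rfl⟩
      refine ⟨?_, hj⟩
      have := j.2
      rw [Finset.mem_Icc]
      omega
    · rintro ⟨hx, hxA⟩
      obtain ⟨j, rfl⟩ := phiC_lift p x hx
      exact ⟨j, hxA, rfl⟩
  have h2 := Finset.card_image_of_injective (phiC p A)
    (f := fun j : Fin p => p - (j : ℕ)) (fun i j h => phiC_sub_inj p i j h)
  rw [h1] at h2
  rw [← h2, Finset.card_sdiff_add_card_eq_card hA]
  simp

theorem phiC_surj (p : ℕ) (t : Finset (Fin p)) :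
    ∃ A, A ⊆ Finset.Icc 1 p ∧ phiC p A = t := by
  refine ⟨(Finset.Icc 1 p).filter fun i => ∀ j ∈ t, p - (j : ℕ) ≠ i,
    Finset.filter_subset _ _, ?_⟩
  ext j
  rw [mem_phiC, Finset.mem_filter]
  constructor
  · intro h
    by_contra hj
    apply h
    refine ⟨?_, fun i hi hij => ?_⟩
    · have := j.2
      rw [Finset.mem_Icc]
      omega
    · exact hj (phiC_sub_inj p i j hij ▸ hi)
  · intro hj h
    exact h.2 j hj rfl

theorem phiC_lex (p : ℕ) (A B : Finset ℕ) (hB : B ⊆ Finset.Icc 1 p) (hA : A ⊆ Finset.Icc 1 p)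
    (h : toColex (phiC p A) < toColex (phiC p B)) : lexLE A B := by
  simp_rw [Finset.Colex.lt_iff_exists_filter_lt, Finset.mem_sdiff, Finset.filter_inj,
    and_assoc] at h
  obtain ⟨j, hjB, hjA, hlt⟩ := h
  rw [mem_phiC] at hjB hjA
  refine Or.inr ⟨p - (j : ℕ), not_not.1 hjA, hjB, fun x hx => ?_⟩
  by_cases hxp : x ∈ Finset.Icc 1 p
  · obtain ⟨i, rfl⟩ := phiC_lift p x hxp
    have hij : j < i := by
      rw [Fin.lt_def]
      omega
    have h1 := hlt hij
    simp only [mem_phiC] at h1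
    tauto
  · exact ⟨fun h => absurd (hA h) hxp, fun h => absurd (hB h) hxp⟩

theorem upShadowIn_sub (p : ℕ) (F : Finset (Finset ℕ)) (hF : ∀ A ∈ F, A ⊆ Finset.Icc 1 p) :
    ∀ A ∈ upShadowIn p F, A ⊆ Finset.Icc 1 p := by
  intro A hA
  simp only [upShadowIn, Finset.mem_biUnion, Finset.mem_image, Finset.mem_sdiff] at hA
  obtain ⟨B, hB, i, ⟨hi, -⟩, rfl⟩ := hA
  exact Finset.insert_subset hi (hF B hB)

theorem phiC_insert (p : ℕ) (A : Finset ℕ) (j : Fin p) :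
    phiC p (insert (p - (j : ℕ)) A) = (phiC p A).erase j := by
  ext i
  rw [mem_phiC, Finset.mem_erase, mem_phiC, Finset.mem_insert]
  have := phiC_sub_inj p i j
  have : i = j → p - (i : ℕ) = p - (j : ℕ) := fun h => by rw [h]
  tauto

theorem phiC_shadow (p : ℕ) (F : Finset (Finset ℕ)) :
    Finset.shadow (F.image (phiC p)) = (upShadowIn p F).image (phiC p) := by
  ext t
  simp only [Finset.mem_shadow_iff, upShadowIn, Finset.mem_image, Finset.mem_biUnion,
    Finset.mem_sdiff]
  constructor
  · rintro ⟨s, ⟨A, hA, rfl⟩, j, hj, rfl⟩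
    rw [mem_phiC] at hj
    refine ⟨_, ⟨A, hA, p - (j : ℕ), ⟨?_, hj⟩, rfl⟩, phiC_insert p A j⟩
    have := j.2
    rw [Finset.mem_Icc]
    omega
  · rintro ⟨_, ⟨A, hA, i, ⟨hi, hiA⟩, rfl⟩, rfl⟩
    obtain ⟨j, rfl⟩ := phiC_lift p i hi
    exact ⟨_, ⟨A, hA, rfl⟩, j, (mem_phiC p A j).2 hiA, (phiC_insert p A j).symm⟩

theorem phiC_card_image (p : ℕ) (F : Finset (Finset ℕ)) (hF : ∀ A ∈ F, A ⊆ Finset.Icc 1 p) :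
    (F.image (phiC p)).card = F.card :=
  Finset.card_image_of_injOn fun A hA B hB h => phiC_inj p A B (hF A hA) (hF B hB) h

theorem phiC_iter (p r : ℕ) : ∀ (F : Finset (Finset ℕ)), (∀ A ∈ F, A ⊆ Finset.Icc 1 p) →
    (Finset.shadow^[r] (F.image (phiC p))).card = ((upShadowIn p)^[r] F).card := by
  induction r with
  | zero => intro F hF; exact phiC_card_image p F hF
  | succ r ih =>
    intro F hF
    rw [Function.iterate_succ_apply, Function.iterate_succ_apply, phiC_shadow]
    exact ih _ (upShadowIn_sub p F hF)

theorem stmt13 (p k : ℕ) (hk : 2 ≤ k) (hp : k - 1 ≤ p)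
    (T I : Finset (Finset ℕ))
    (hT : T ⊆ Finset.powersetCard (k - 1) (Finset.Icc 1 p))
    (hI : I ⊆ Finset.powersetCard (k - 1) (Finset.Icc 1 p))
    (hIinit : ∀ S ∈ I, ∀ U ∈ Finset.powersetCard (k - 1) (Finset.Icc 1 p),
      lexLE U S → U ∈ I)
    (hcard : I.card = T.card) :
    ∀ r : ℕ, 1 ≤ r → r ≤ p - k + 1 →
      ((upShadowIn p)^[r] I).card ≤ ((upShadowIn p)^[r] T).card := by
  intro r _ _
  have hT' : ∀ A ∈ T, A ⊆ Finset.Icc 1 p := fun A h => (Finset.mem_powersetCard.1 (hT h)).1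
  have hI' : ∀ A ∈ I, A ⊆ Finset.Icc 1 p := fun A h => (Finset.mem_powersetCard.1 (hI h)).1
  rw [← phiC_iter p r I hI', ← phiC_iter p r T hT']
  have sized : ∀ F : Finset (Finset ℕ), F ⊆ Finset.powersetCard (k - 1) (Finset.Icc 1 p) →
      ((F.image (phiC p) : Finset (Finset (Fin p))) : Set (Finset (Fin p))).Sized
        (p - (k - 1)) := by
    intro F hF s hs
    rw [Finset.mem_coe, Finset.mem_image] at hs
    obtain ⟨A, hA, rfl⟩ := hs
    have h1 := Finset.mem_powersetCard.1 (hF hA)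
    have h2 := phiC_card p A h1.1
    omega
  refine Finset.iterated_kk (sized T hT) ?_ ⟨sized I hI, ?_⟩
  · rw [phiC_card_image p I hI', phiC_card_image p T hT', hcard]
  · rintro s t hs ⟨hts, htc⟩
    rw [Finset.mem_image] at hs
    obtain ⟨S, hS, rfl⟩ := hs
    obtain ⟨U, hU, rfl⟩ := phiC_surj p t
    refine Finset.mem_image_of_mem _ (hIinit S hS U ?_ ?_)
    · rw [Finset.mem_powersetCard]
      have := phiC_card p U hU
      exact ⟨hU, by omega⟩
    · exact phiC_lex p U S (hI' S hS) hU hts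
end

section
/- Let p and k be integers with 2 ≤ k and k − 1 ≤ p. Let 𝒯 ⊆ [p]^(k−1) and let ℐ ⊆ [p]^(k−1) be the initial segment of the lex order on [p]^(k−1) with |ℐ| = |𝒯|. Then |U_𝒯| ≥ |U_ℐ|, where for a family ℱ ⊆ [p]^(k−1) the total upper shadow is U_ℱ = { A ⊆ [p] : X ⊆ A for some X ∈ ℱ }. -/
/-- Reverse and complement. -/
def revCompl (p : ℕ) (A : Finset ℕ) : Finset (Fin p) :=
  Finset.univ.filter fun j : Fin p => p - (j : ℕ) ∉ A

theorem mem_revCompl {p : ℕ} {A : Finset ℕ} {j : Fin p} :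
    j ∈ revCompl p A ↔ p - (j : ℕ) ∉ A := by simp [revCompl]

theorem not_mem_revCompl_mk {p : ℕ} {A : Finset ℕ} {x : ℕ} (hx : x ∈ Finset.Icc 1 p)
    (h : p - x < p) : (⟨p - x, h⟩ : Fin p) ∈ revCompl p A ↔ x ∉ A := by
  rw [mem_revCompl]
  rw [Finset.mem_Icc] at hx
  have : p - (p - x) = x := by omega
  simp [this]

theorem revCompl_subset {p : ℕ} {X A : Finset ℕ} (hX : X ⊆ Finset.Icc 1 p) :
    revCompl p A ⊆ revCompl p X ↔ X ⊆ A := by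
  constructor
  · intro h x hx
    have hx' := hX hx
    have hlt : p - x < p := by rw [Finset.mem_Icc] at hx'; omega
    by_contra hA
    exact (not_mem_revCompl_mk hx' hlt).1 (h ((not_mem_revCompl_mk hx' hlt).2 hA)) hx
  · intro h j hj
    rw [mem_revCompl] at *
    exact fun h' => hj (h h')

theorem revCompl_inj {p : ℕ} {X A : Finset ℕ} (hX : X ⊆ Finset.Icc 1 p)
    (hA : A ⊆ Finset.Icc 1 p) (h : revCompl p A = revCompl p X) : A = X :=
  Finset.Subset.antisymm ((revCompl_subset hA).1 h.ge) ((revCompl_subset hX).1 h.le)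

theorem revCompl_card {p : ℕ} {A : Finset ℕ} (hA : A ⊆ Finset.Icc 1 p) :
    (revCompl p A).card = p - A.card := by
  have h1 : (revCompl p A)ᶜ.card = A.card := by
    refine Finset.card_bij (fun j _ => p - (j : ℕ)) ?_ ?_ ?_
    · intro j hj
      simpa [mem_revCompl] using hj
    · intro a _ b _ h
      ext
      have := a.2
      have := b.2
      omega
    · intro x hx
      have hx' := hA hx
      have hlt : p - x < p := by rw [Finset.mem_Icc] at hx'; omega
      refine ⟨⟨p - x, hlt⟩, ?_, ?_⟩
      · rw [Finset.mem_compl, not_mem_revCompl_mk hx' hlt]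
        simpa using hx
      · rw [Finset.mem_Icc] at hx'
        simp only
        omega
  have h2 := Finset.card_add_card_compl (revCompl p A)
  rw [Fintype.card_fin] at h2
  omega

theorem revCompl_surj {p : ℕ} (S : Finset (Fin p)) :
    ∃ A, A ⊆ Finset.Icc 1 p ∧ revCompl p A = S := by
  refine ⟨Sᶜ.image fun j : Fin p => p - (j : ℕ), ?_, ?_⟩
  · intro x hx
    obtain ⟨j, _, rfl⟩ := Finset.mem_image.1 hx
    have := j.2
    rw [Finset.mem_Icc]
    omega
  · ext j
    rw [mem_revCompl, Finset.mem_image]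
    constructor
    · intro h
      by_contra hj
      exact h ⟨j, by simpa using hj, rfl⟩
    · rintro hj ⟨i, hi, hij⟩
      have : i = j := by
        ext
        have := i.2
        have := j.2
        omega
      subst this
      simp [hj] at hi

open Finset in
theorem card_up_eq {p m : ℕ} {F : Finset (Finset ℕ)}
    (hF : F ⊆ powersetCard m (Icc 1 p)) :
    ((Icc 1 p).powerset.filter fun A => ∃ X ∈ F, X ⊆ A).card =
      ∑ i ∈ range (p + 1), (shadow^[i] (F.image (revCompl p))).card := by
  have hs : ∀ X ∈ F, X ⊆ Icc 1 p := fun X hX => (mem_powersetCard.1 (hF hX)).1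
  have hc : ∀ X ∈ F, X.card = m := fun X hX => (mem_powersetCard.1 (hF hX)).2
  rw [Finset.card_eq_sum_card_fiberwise (f := fun A => A.card - m) (t := range (p + 1))]
  · refine sum_congr rfl fun i hi => ?_
    refine Finset.card_bij (fun A _ => revCompl p A) ?_ ?_ ?_
    · intro A hA
      simp only [mem_filter, mem_powerset] at hA
      obtain ⟨⟨hAp, X, hX, hXA⟩, hi⟩ := hA
      rw [mem_shadow_iterate_iff_exists_sdiff]
      have hsub := (revCompl_subset (A := A) (hs X hX)).2 hXA
      refine ⟨_, mem_image_of_mem _ hX, hsub, ?_⟩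
      rw [card_sdiff_of_subset hsub, revCompl_card hAp, revCompl_card (hs X hX), hc X hX]
      have h1 := card_le_card hAp
      have h2 := card_le_card hXA
      rw [hc X hX] at h2
      simp at h1
      omega
    · intro A hA B hB h
      simp only [mem_filter, mem_powerset] at hA hB
      exact revCompl_inj hB.1.1 hA.1.1 h
    · intro S hS
      rw [mem_shadow_iterate_iff_exists_sdiff] at hS
      obtain ⟨Y, hY, hSY, hcard⟩ := hS
      obtain ⟨X, hX, rfl⟩ := mem_image.1 hY
      obtain ⟨A, hA, rfl⟩ := revCompl_surj S
      have hXA := (revCompl_subset (hs X hX)).1 hSY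
      refine ⟨A, ?_, rfl⟩
      simp only [mem_filter, mem_powerset]
      refine ⟨⟨hA, X, hX, hXA⟩, ?_⟩
      rw [card_sdiff_of_subset hSY, revCompl_card hA, revCompl_card (hs X hX), hc X hX] at hcard
      have h1 := card_le_card hA
      have h2 := card_le_card hXA
      rw [hc X hX] at h2
      simp at h1
      omega
  · intro A hA
    simp only [coe_filter, mem_powerset, Set.mem_ofPred_eq] at hA
    have h1 := card_le_card hA.1
    simp at h1
    simp
    omega

theorem lexLE_of_colex {p : ℕ} {A B : Finset ℕ} (hA : A ⊆ Finset.Icc 1 p)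
    (hB : B ⊆ Finset.Icc 1 p)
    (h : toColex (revCompl p A) < toColex (revCompl p B)) : lexLE A B := by
  rw [Finset.Colex.toColex_lt_toColex_iff_exists_forall_lt] at h
  obtain ⟨a, ha, ha', hlt⟩ := h
  rw [mem_revCompl] at ha ha'
  have hap := a.2
  have hex : ∃ x, ¬ (x ∈ A ↔ x ∈ B) := ⟨p - a, by tauto⟩
  classical
  have hm := Nat.find_spec hex
  have hmin : ∀ x < Nat.find hex, (x ∈ A ↔ x ∈ B) := fun x hx =>
    not_not.1 (Nat.find_min hex hx)
  have hle : Nat.find hex ≤ p - a := Nat.find_min' hex (by tauto)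
  generalize Nat.find hex = m at *
  refine Or.inr ⟨m, ?_⟩
  suffices h : m ∈ A by exact ⟨h, by tauto, hmin⟩
  by_contra hmA
  have hmB : m ∈ B := by tauto
  have hmI := hB hmB
  have hlt' : p - m < p := by rw [Finset.mem_Icc] at hmI; omega
  have := hlt ⟨p - m, hlt'⟩ ((not_mem_revCompl_mk hmI hlt').2 hmA)
    (fun h => (not_mem_revCompl_mk hmI hlt').1 h hmB)
  rw [Fin.lt_def] at this
  simp only at this
  rw [Finset.mem_Icc] at hmI
  omega

theorem stmt14 (p k : ℕ) (hk : 2 ≤ k) (hp : k - 1 ≤ p)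
    (T I : Finset (Finset ℕ))
    (hT : T ⊆ Finset.powersetCard (k - 1) (Finset.Icc 1 p))
    (hI : I ⊆ Finset.powersetCard (k - 1) (Finset.Icc 1 p))
    (hIinit : ∀ S ∈ I, ∀ U ∈ Finset.powersetCard (k - 1) (Finset.Icc 1 p),
      lexLE U S → U ∈ I)
    (hcard : I.card = T.card) :
    ((Finset.Icc 1 p).powerset.filter fun A => ∃ X ∈ I, X ⊆ A).card ≤
      ((Finset.Icc 1 p).powerset.filter fun A => ∃ X ∈ T, X ⊆ A).card := by
  rw [card_up_eq hI, card_up_eq hT]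
  have hsized : ∀ F : Finset (Finset ℕ), F ⊆ Finset.powersetCard (k - 1) (Finset.Icc 1 p) →
      ((F.image (revCompl p) : Finset (Finset (Fin p))) : Set (Finset (Fin p))).Sized
        (p - (k - 1)) := by
    intro F hF S hS
    obtain ⟨X, hX, rfl⟩ := Finset.mem_image.1 (Finset.mem_coe.1 hS)
    have := Finset.mem_powersetCard.1 (hF hX)
    rw [revCompl_card this.1, this.2]
  have hcd : ∀ F : Finset (Finset ℕ), F ⊆ Finset.powersetCard (k - 1) (Finset.Icc 1 p) →
      (F.image (revCompl p)).card = F.card := by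
    intro F hF
    refine Finset.card_image_of_injOn fun A hA B hB h => ?_
    exact revCompl_inj (Finset.mem_powersetCard.1 (hF hB)).1
      (Finset.mem_powersetCard.1 (hF hA)).1 h
  refine Finset.sum_le_sum fun i _ => ?_
  refine Finset.iterated_kk (hsized T hT) (by rw [hcd T hT, hcd I hI, hcard]) ⟨hsized I hI, ?_⟩
  rintro S U hS ⟨hlt, hU⟩
  obtain ⟨X, hX, rfl⟩ := Finset.mem_image.1 hS
  obtain ⟨A, hA, rfl⟩ := revCompl_surj U
  refine Finset.mem_image_of_mem _ (hIinit X hX A ?_ ?_)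
  · rw [Finset.mem_powersetCard]
    refine ⟨hA, ?_⟩
    rw [revCompl_card hA] at hU
    have h1 := Finset.card_le_card hA
    simp at h1
    omega
  · exact lexLE_of_colex hA (Finset.mem_powersetCard.1 (hI hX)).1 hlt
end

section
/- Let 𝒜 be a finite family of distinct 2-element subsets of ℕ, regarded as the edge set of a graph G with vertex set V = ∪𝒜. Suppose G has diameter at most 2, i.e. any two distinct vertices of V are either adjacent in G or have a common neighbour. Let t be a positive integer with |⟨𝒜⟩| < 2^t − 1. Then for every x ∈ V, the number of vertices of V lying outside Γ(x) is less than t, where Γ(x) consists of x together with all vertices adjacent to x. -/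
theorem stmt15 (A : Finset (Finset ℕ)) (hA : ∀ S ∈ A, S.card = 2)
    (hdiam : ∀ x ∈ A.sup id, ∀ y ∈ A.sup id, x ≠ y →
      ({x, y} : Finset ℕ) ∈ A ∨
        ∃ z ∈ A.sup id, ({x, z} : Finset ℕ) ∈ A ∧ ({y, z} : Finset ℕ) ∈ A)
    (t : ℕ) (ht : 0 < t) (hcard : (unionClosure A).card < 2 ^ t - 1) :
    ∀ x ∈ A.sup id,
      ((A.sup id) \
        insert x ((A.sup id).filter fun y => ({x, y} : Finset ℕ) ∈ A)).card < t := by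
  intro x hx
  by_contra! hle
  set W := (A.sup id) \
        insert x ((A.sup id).filter fun y => ({x, y} : Finset ℕ) ∈ A) with hW
  have key : ∀ y ∈ W, ∃ z, ({y, z} : Finset ℕ) ∈ A ∧ z ∉ W := by
    intro y hy
    rw [hW, Finset.mem_sdiff, Finset.mem_insert, Finset.mem_filter] at hy
    obtain ⟨hyV, hy2⟩ := hy
    push Not at hy2
    rcases hdiam x hx y hyV (fun h => hy2.1 h.symm) with h | ⟨z, hz, h1, h2⟩
    · exact absurd h (hy2.2 hyV)
    · refine ⟨z, h2, fun hzW => ?_⟩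
      rw [hW, Finset.mem_sdiff, Finset.mem_insert, Finset.mem_filter] at hzW
      exact hzW.2 (Or.inr ⟨hz, h1⟩)
  choose! f hf1 hf2 using key
  have hmem : ∀ T ∈ W.powerset.erase ∅,
      (T.image fun y => ({y, f y} : Finset ℕ)).sup id ∈ unionClosure A := by
    intro T hT
    rw [Finset.mem_erase, Finset.mem_powerset] at hT
    refine Finset.mem_image.2 ⟨_, Finset.mem_filter.2 ⟨Finset.mem_powerset.2 ?_, ?_⟩, rfl⟩
    · intro S hS
      obtain ⟨y, hy, rfl⟩ := Finset.mem_image.1 hS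
      exact hf1 y (hT.2 hy)
    · exact (Finset.nonempty_iff_ne_empty.2 hT.1).image _
  have hint : ∀ T ⊆ W, ((T.image fun y => ({y, f y} : Finset ℕ)).sup id) ∩ W = T := by
    intro T hT
    ext a
    simp only [Finset.mem_inter, Finset.mem_sup, Finset.mem_image, id]
    constructor
    · rintro ⟨⟨S, ⟨y, hy, rfl⟩, ha⟩, haW⟩
      rw [Finset.mem_insert, Finset.mem_singleton] at ha
      rcases ha with rfl | rfl
      · exact hy
      · exact absurd haW (hf2 y (hT hy))
    · intro ha
      exact ⟨⟨_, ⟨a, ha, rfl⟩, by simp⟩, hT ha⟩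
  have hle2 : (W.powerset.erase ∅).card ≤ (unionClosure A).card := by
    refine Finset.card_le_card_of_injOn _ hmem ?_
    intro T hT T' hT' h
    have h1 := hint T (Finset.mem_powerset.1 (Finset.mem_of_mem_erase hT))
    have h2 := hint T' (Finset.mem_powerset.1 (Finset.mem_of_mem_erase hT'))
    rw [← h1, ← h2]
    exact congrArg (· ∩ W) h
  rw [Finset.card_erase_of_mem (Finset.empty_mem_powerset W), Finset.card_powerset] at hle2
  have h3 : 2 ^ t ≤ 2 ^ W.card := Nat.pow_le_pow_right (by norm_num) hle
  omega
end
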